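/- There is a function f : ℕ → ℕ such that the following holds: if G is a finite non-abelian simple group in which every element g has a right Engel sink of cardinality at most m, then |G| ≤ f(m). -/

import Mathlib

/-- The commutator `[a,b] = a⁻¹ b⁻¹ a b`. -/
def cmtr {G : Type*} [Group G] (a b : G) : G := a⁻¹ * b⁻¹ * a * b

/-- `engel a b n` is the left-normed Engel commutator `[a,_n b] = [[...[[a,b],b],...],b]`
with `b` repeated `n` times. -/
def engel {G : Type*} [Group G] (a b : G) : ℕ → G
  | 0 => a
  | n + 1 => cmtr (engel a b n) b

/-- A finite subset `R` of `G` is a right Engel sink for `g` if for every `x ∈ G` there is a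
positive integer `n₀` such that `[g,_n x] ∈ R` for all `n ≥ n₀`. -/
def IsRightEngelSink {G : Type*} [Group G] (g : G) (R : Set G) : Prop :=
  R.Finite ∧ ∀ x : G, ∃ n₀ : ℕ, 0 < n₀ ∧ ∀ n ≥ n₀, engel g x n ∈ R

/-- A finite subset `E` of `G` is a left Engel sink for `g` if for every `x ∈ G` there is a
positive integer `n₀` such that `[x,_n g] ∈ E` for all `n ≥ n₀`. -/
def IsLeftEngelSink {G : Type*} [Group G] (g : G) (E : Set G) : Prop :=
  E.Finite ∧ ∀ x : G, ∃ n₀ : ℕ, 0 < n₀ ∧ ∀ n ≥ n₀, engel x g n ∈ E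

/-- An element is almost right Engel if it admits a finite right Engel sink. -/
def AlmostRightEngel {G : Type*} [Group G] (g : G) : Prop :=
  ∃ R : Set G, IsRightEngelSink g R

/-- A group is locally nilpotent if every finitely generated subgroup is nilpotent. -/
def LocallyNilpotent (G : Type*) [Group G] : Prop :=
  ∀ H : Subgroup G, H.FG → Group.IsNilpotent H

universe u

section EngelBasics

variable {G H : Type*} [Group G] [Group H]

@[simp] theorem engel_zero (a b : G) : engel a b 0 = a := rfl

theorem engel_succ (a b : G) (n : ℕ) : engel a b (n + 1) = cmtr (engel a b n) b := rfl

theorem cmtr_eq_one_iff {a b : G} : cmtr a b = 1 ↔ Commute a b := by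
  unfold cmtr
  rw [Commute, SemiconjBy, mul_assoc, mul_assoc, inv_mul_eq_one, eq_inv_mul_iff_mul_eq]
  exact eq_comm

theorem engel_add (a b : G) (m n : ℕ) : engel a b (m + n) = engel (engel a b m) b n := by
  induction n with
  | zero => rfl
  | succ n ih => rw [← add_assoc, engel_succ, engel_succ, ih]

@[simp] theorem engel_one_left (b : G) (n : ℕ) : engel 1 b n = 1 := by
  induction n with
  | zero => rfl
  | succ n ih => rw [engel_succ, ih]; simp [cmtr]

theorem map_cmtr (f : G →* H) (a b : G) : f (cmtr a b) = cmtr (f a) (f b) := by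
  simp [cmtr]

theorem map_engel (f : G →* H) (a b : G) (n : ℕ) : f (engel a b n) = engel (f a) (f b) n := by
  induction n with
  | zero => rfl
  | succ n ih => rw [engel_succ, engel_succ, map_cmtr, ih]

theorem engel_conj (g a b : G) (n : ℕ) :
    engel (g * a * g⁻¹) (g * b * g⁻¹) n = g * engel a b n * g⁻¹ :=
  (map_engel (MulAut.conj g).toMonoidHom a b n).symm

theorem engel_mem {K : Subgroup G} {a b : G} (ha : a ∈ K) (hb : b ∈ K) (n : ℕ) :
    engel a b n ∈ K := by
  induction n with
  | zero => exact ha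
  | succ n ih =>
    exact K.mul_mem (K.mul_mem (K.mul_mem (K.inv_mem ih) (K.inv_mem hb)) ih) hb

theorem engel_coe {K : Subgroup G} (a b : K) (n : ℕ) :
    ((engel a b n : K) : G) = engel (a : G) (b : G) n :=
  map_engel K.subtype a b n

/-- Heineken's identity. -/
theorem engel_heineken (g h : G) (n : ℕ) :
    engel g h (n + 2) = (g * h)⁻¹ * engel h⁻¹ (g * h * g⁻¹) (n + 1) * (g * h) := by
  induction n with
  | zero => simp [engel_succ, cmtr]; group
  | succ n ih =>
    rw [engel_succ, ih, engel_succ h⁻¹ _ (n + 1)]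
    generalize engel h⁻¹ (g * h * g⁻¹) (n + 1) = y
    simp only [cmtr]
    group

theorem engel_mul_left_of_commute {c g y : G} (h : Commute c y) (n : ℕ) :
    engel (c * g) y (n + 1) = engel g y (n + 1) := by
  induction n with
  | zero =>
    have : c⁻¹ * y⁻¹ * c = y⁻¹ := by
      rw [(h.inv_inv).eq]; group
    simp only [engel_succ, cmtr, engel_zero]
    calc (c * g)⁻¹ * y⁻¹ * (c * g) * y = g⁻¹ * (c⁻¹ * y⁻¹ * c) * g * y := by group
      _ = _ := by rw [this]
  | succ n ih => rw [engel_succ, ih, ← engel_succ]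

/-- `engel g x n` is eventually trivial. -/
def Eng (g x : G) : Prop := ∃ n, engel g x n = 1

theorem engel_eq_one_of_le {g x : G} {n m : ℕ} (h : engel g x n = 1) (hm : n ≤ m) :
    engel g x m = 1 := by
  obtain ⟨k, rfl⟩ := Nat.exists_eq_add_of_le hm
  rw [engel_add, h, engel_one_left]

theorem Eng.conj {g x : G} (h : Eng g x) (a : G) : Eng (a * g * a⁻¹) (a * x * a⁻¹) := by
  obtain ⟨n, hn⟩ := h
  exact ⟨n, by rw [engel_conj, hn]; group⟩

theorem eng_heineken {g h : G} : Eng g h ↔ Eng h⁻¹ (g * h * g⁻¹) := by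
  constructor
  · rintro ⟨n, hn⟩
    have := engel_eq_one_of_le hn (Nat.le_add_right n 2)
    rw [engel_heineken] at this
    refine ⟨n + 1, ?_⟩
    have h2 := congrArg (fun x => g * h * x * (g * h)⁻¹) this
    simpa [mul_assoc] using h2
  · rintro ⟨n, hn⟩
    refine ⟨n + 2, ?_⟩
    rw [engel_heineken, engel_eq_one_of_le hn (Nat.le_add_right n 1)]
    group

/-- The minimal right Engel sink of `g` (for finite groups): the elements that recur in
some Engel sequence of `g`. -/
def rsink (g : G) : Set G :=
  {h | ∃ x, (∃ n, engel g x n = h) ∧ ∃ k, 0 < k ∧ engel h x k = h}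

theorem engel_mul_period {h x : G} {k : ℕ} (hk : engel h x k = h) (j : ℕ) :
    engel h x (k * j) = h := by
  induction j with
  | zero => rfl
  | succ j ih => rw [mul_add, mul_one, engel_add, ih, hk]

theorem rsink_subset {g : G} {R : Set G} (hR : IsRightEngelSink g R) : rsink g ⊆ R := by
  rintro h ⟨x, ⟨n, hn⟩, k, hk, hkh⟩
  obtain ⟨n₀, -, h₀⟩ := hR.2 x
  have := h₀ (n + k * n₀) (by nlinarith)
  rwa [engel_add, hn, engel_mul_period hkh] at this

/-- In a finite group every Engel sequence is eventually periodic. -/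
theorem engel_eventually_periodic [Finite G] (g x : G) :
    ∃ N k, 0 < k ∧ ∀ n, N ≤ n → engel (engel g x n) x k = engel g x n := by
  obtain ⟨i, j, hij, h⟩ := Finite.exists_ne_map_eq_of_infinite (fun n : ℕ => engel g x n)
  wlog hlt : i < j generalizing i j
  · exact this j i hij.symm h.symm (by omega)
  refine ⟨i, j - i, by omega, fun n hn => ?_⟩
  obtain ⟨l, rfl⟩ := Nat.exists_eq_add_of_le hn
  rw [← engel_add, show i + l + (j - i) = j + l by omega, engel_add g x j, engel_add g x i]
  exact congrArg (fun y => engel y x l) h.symm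

theorem eventually_mem_rsink [Finite G] (g x : G) :
    ∃ N, ∀ n, N ≤ n → engel g x n ∈ rsink g := by
  obtain ⟨N, k, hk, h⟩ := engel_eventually_periodic g x
  exact ⟨N, fun n hn => ⟨x, ⟨n, rfl⟩, k, hk, h n hn⟩⟩

theorem not_eng_of_periodic {z x : G} {k : ℕ} (hk : 0 < k) (h : engel z x k = z) (hz : z ≠ 1) :
    ¬ Eng z x := by
  rintro ⟨n, hn⟩
  apply hz
  rw [← engel_mul_period h n]
  exact engel_eq_one_of_le hn (by nlinarith)

/-- If `g` fails to be Engel against `x` there is a nontrivial periodic element in the sink. -/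
theorem exists_periodic_of_not_eng [Finite G] {g x : G} (h : ¬ Eng g x) :
    ∃ z, z ≠ 1 ∧ (∃ k, 0 < k ∧ engel z x k = z) ∧ (∀ i, engel z x i ∈ rsink g) ∧
      ∃ n, engel g x n = z := by
  obtain ⟨N, k, hk, hN⟩ := engel_eventually_periodic g x
  refine ⟨engel g x N, fun h1 => h ⟨N, h1⟩, ⟨k, hk, hN N le_rfl⟩, fun i => ?_, N, rfl⟩
  exact ⟨x, ⟨N + i, engel_add ..⟩, k, hk, by
    rw [← engel_add g x N i]; exact hN _ (by omega)⟩

theorem conj_mem_rsink {g h : G} (hh : h ∈ rsink g) (a : G) :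
    a * h * a⁻¹ ∈ rsink (a * g * a⁻¹) := by
  obtain ⟨x, ⟨n, hn⟩, k, hk, hkh⟩ := hh
  exact ⟨a * x * a⁻¹, ⟨n, by rw [engel_conj, hn]⟩, k, hk, by rw [engel_conj, hkh]⟩

theorem conj_mem_rsink_of_commute {g h : G} (hh : h ∈ rsink g) {a : G} (ha : Commute a g) :
    a * h * a⁻¹ ∈ rsink g := by
  have := conj_mem_rsink hh a
  rwa [ha.eq, mul_inv_cancel_right] at this

/-- The sinks of a finite group all have at most `m` elements. -/
def SinksLE (G : Type*) [Group G] (m : ℕ) : Prop := ∀ g : G, (rsink g).ncard ≤ m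

theorem rsink_map_subset [Finite G] (f : G →* H) (hf : Function.Surjective f) (g : G) :
    rsink (f g) ⊆ f '' rsink g := by
  rintro h' ⟨x', ⟨n, hn⟩, k, hk, hkh⟩
  obtain ⟨x, rfl⟩ := hf x'
  obtain ⟨N, hN⟩ := eventually_mem_rsink g x
  refine ⟨_, hN (n + k * N) (by nlinarith), ?_⟩
  rw [map_engel, engel_add, hn, engel_mul_period hkh]

theorem SinksLE.of_surjective [Finite G] {m : ℕ} (h : SinksLE G m) (f : G →* H)
    (hf : Function.Surjective f) : SinksLE H m := by
  intro g'
  obtain ⟨g, rfl⟩ := hf g'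
  exact (Set.ncard_le_ncard (rsink_map_subset f hf g) (Set.toFinite _)).trans
    ((Set.ncard_image_le (Set.toFinite _)).trans (h g))

theorem coe_mem_rsink {K : Subgroup G} {g h : K} (hh : h ∈ rsink g) : (h : G) ∈ rsink (g : G) := by
  obtain ⟨x, ⟨n, hn⟩, k, hk, hkh⟩ := hh
  exact ⟨x, ⟨n, by rw [← engel_coe, hn]⟩, k, hk, by rw [← engel_coe, hkh]⟩

theorem eng_of_isNilpotent [Group.IsNilpotent G] (a b : G) : Eng a b := by
  obtain ⟨n, hn⟩ := Subgroup.nilpotent_iff_lowerCentralSeries.1 ‹Group.IsNilpotent G›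
  refine ⟨n, ?_⟩
  have : ∀ i, engel a b i ∈ (⊤ : Subgroup G).lowerCentralSeries i := by
    intro i
    induction i with
    | zero => simp
    | succ i ih =>
      have := Subgroup.commutator_mem_commutator
        (Subgroup.inv_mem _ ih) (Subgroup.mem_top b⁻¹)
      rw [Subgroup.lowerCentralSeries_succ]
      simpa [commutatorElement_def, engel_succ, cmtr] using this
  simpa [hn] using this n

end EngelBasics

section CoprimeAction

variable {G : Type*} [Group G]

theorem lowerCentralSeries_normal (O : Subgroup G) [O.Normal] (n : ℕ) :
    (O.lowerCentralSeries n).Normal := by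
  induction n with
  | zero => assumption
  | succ n ih => rw [Subgroup.lowerCentralSeries_succ]; infer_instance

/-- An element of a nilpotent normal subgroup `O` is trivial if it lies in every normal subgroup
modulo which its conjugates centralize `O`. -/
theorem eq_one_of_central_descent {O : Subgroup G} [O.Normal] [Group.IsNilpotent O] {c : G}
    (hc : c ∈ O)
    (h : ∀ N : Subgroup G, ∀ [N.Normal],
      (∀ g o : G, o ∈ O → Commute ((g * c * g⁻¹ : G) : G ⧸ N) (o : G ⧸ N)) → c ∈ N) :
    c = 1 := by
  obtain ⟨n, hn⟩ := (Subgroup.isNilpotent_iff_lowerCentralSeries O).1 ‹_›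
  have key : ∀ i, c ∈ O.lowerCentralSeries i := by
    intro i
    induction i with
    | zero => exact hc
    | succ i ih =>
      have hnorm := lowerCentralSeries_normal O i
      have hnorm' := lowerCentralSeries_normal O (i + 1)
      refine h _ fun g o ho => ?_
      have h1 := Subgroup.commutator_mem_commutator (hnorm.conj_mem c ih g) ho
      rw [← Subgroup.lowerCentralSeries_succ] at h1
      rw [← commutatorElement_eq_one_iff_commute, ← QuotientGroup.mk'_apply, ← QuotientGroup.mk'_apply,
        ← map_commutatorElement, QuotientGroup.mk'_apply, QuotientGroup.eq_one_iff]
      exact h1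
  simpa [hn] using key n

theorem cmtr_injOn_of_normal [Finite G] {p : ℕ} [Fact p.Prime] {O : Subgroup G} [O.Normal]
    (hO : IsPGroup p O) {f : G} (hf : p.Coprime (orderOf f)) {w w' : G} (hw : w ∈ O)
    (hw' : w' ∈ O) (h : cmtr (cmtr w f) f = cmtr (cmtr w' f) f) : cmtr w f = cmtr w' f := by
  have := hO.isNilpotent
  have hmem : ∀ x ∈ O, cmtr x f ∈ O := fun x hx => by
    have := O.mul_mem (O.inv_mem hx) (‹O.Normal›.conj_mem x hx f⁻¹)
    simpa [cmtr, mul_assoc] using this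
  set a := cmtr w f with ha
  set b := cmtr w' f with hb
  have hbf : Commute (b * a⁻¹) f := by
    rw [← cmtr_eq_one_iff]
    have h1 : a⁻¹ * f⁻¹ * a = b⁻¹ * f⁻¹ * b := mul_right_cancel h
    calc (b * a⁻¹)⁻¹ * f⁻¹ * (b * a⁻¹) * f = a * (b⁻¹ * f⁻¹ * b) * a⁻¹ * f := by group
      _ = 1 := by rw [← h1]; group
  have hc : b * a⁻¹ ∈ O := O.mul_mem (hmem _ hw') (O.inv_mem (hmem _ hw))
  have hfa : f * a⁻¹ = w⁻¹ * f * w⁻¹⁻¹ := by rw [ha, cmtr]; group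
  have hfb : f * b⁻¹ = w'⁻¹ * f * w'⁻¹⁻¹ := by rw [hb, cmtr]; group
  have hpow : ∀ x : G, (x * f * x⁻¹) ^ orderOf f = 1 := fun x => by
    rw [conj_pow, pow_orderOf_eq_one]; group
  obtain ⟨k, hk⟩ := hO ⟨_, hc⟩
  have hk' : (b * a⁻¹) ^ p ^ k = 1 := by simpa using congrArg Subtype.val hk
  have : b * a⁻¹ = 1 := by
    refine eq_one_of_central_descent hc fun N _ hN => ?_
    rw [← QuotientGroup.eq_one_iff]
    have h1 : Commute ((b * a⁻¹ : G) : G ⧸ N) ((f * a⁻¹ : G) : G ⧸ N) := by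
      rw [QuotientGroup.mk_mul N f]
      refine Commute.mul_right (by simpa using hbf.map (QuotientGroup.mk' N)) ?_
      simpa using hN 1 a⁻¹ (O.inv_mem (hmem _ hw))
    have h2 : ((f * b⁻¹ : G) : G ⧸ N) = ((f * a⁻¹ : G) : G ⧸ N) * ((b * a⁻¹ : G) : G ⧸ N)⁻¹ := by
      rw [← QuotientGroup.mk_inv, ← QuotientGroup.mk_mul]; congr 1; group
    have h3 := h1.symm.inv_right.mul_pow (orderOf f)
    rw [← h2, hfa, hfb, ← QuotientGroup.mk_pow, hpow, ← QuotientGroup.mk_pow, hpow] at h3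
    have h4 : ((b * a⁻¹ : G) : G ⧸ N) ^ orderOf f = 1 := by
      rw [← inv_eq_one, ← inv_pow]; simpa only [QuotientGroup.mk_one, one_mul] using h3.symm
    have h5 : ((b * a⁻¹ : G) : G ⧸ N) ^ p ^ k = 1 := by
      rw [← QuotientGroup.mk_pow, hk']; rfl
    have h6 := Nat.Coprime.pow_left k hf
    rw [← orderOf_eq_one_iff]
    exact Nat.dvd_one.1 (h6 ▸ Nat.dvd_gcd (orderOf_dvd_of_pow_eq_one h5)
      (orderOf_dvd_of_pow_eq_one h4))
  exact (mul_inv_eq_one.1 this).symm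

theorem cmtr_injOn [Finite G] {p : ℕ} [Fact p.Prime] {O : Subgroup G}
    (hO : IsPGroup p O) {f : G} (hf : p.Coprime (orderOf f))
    (hfO : f ∈ Subgroup.normalizer (O : Set G)) {w w' : G} (hw : w ∈ O)
    (hw' : w' ∈ O) (h : cmtr (cmtr w f) f = cmtr (cmtr w' f) f) : cmtr w f = cmtr w' f := by
  let K := Subgroup.normalizer (O : Set G)
  have hle : O ≤ K := Subgroup.le_normalizer
  have := cmtr_injOn_of_normal (G := K) (O := O.subgroupOf K)
    (hO.comap_of_injective K.subtype K.subtype_injective) (f := ⟨f, hfO⟩)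
    (by simpa [Subgroup.orderOf_mk] using hf) (w := ⟨w, hle hw⟩) (w' := ⟨w', hle hw'⟩)
    (by simpa [Subgroup.mem_subgroupOf] using hw) (by simpa [Subgroup.mem_subgroupOf] using hw')
    (by ext; simpa [cmtr] using h)
  simpa [cmtr] using congrArg Subtype.val this

theorem cmtr_mem_of_mem_normalizer {O : Subgroup G} {f : G}
    (hfO : f ∈ Subgroup.normalizer (O : Set G)) {x : G} (hx : x ∈ O) : cmtr x f ∈ O := by
  have := O.mul_mem (O.inv_mem hx) ((Subgroup.mem_normalizer_iff.1 (inv_mem hfO) x).1 hx)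
  simpa [cmtr, mul_assoc] using this

theorem engel_mem_of_mem_normalizer {O : Subgroup G} {f : G}
    (hfO : f ∈ Subgroup.normalizer (O : Set G)) {x : G} (hx : x ∈ O) (n : ℕ) :
    engel x f n ∈ O := by
  induction n with
  | zero => exact hx
  | succ n ih => exact cmtr_mem_of_mem_normalizer hfO ih

/-- A coprime Engel action on a `p`-group element is trivial. -/
theorem commute_of_eng [Finite G] {p : ℕ} [Fact p.Prime] {O : Subgroup G}
    (hO : IsPGroup p O) {f : G} (hf : p.Coprime (orderOf f))
    (hfO : f ∈ Subgroup.normalizer (O : Set G)) {e : G} (he : e ∈ O) (h : Eng e f) :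
    Commute e f := by
  obtain ⟨n, h₀⟩ := h
  have hn := engel_eq_one_of_le h₀ (Nat.le_succ n)
  clear h₀
  rw [← cmtr_eq_one_iff]
  induction n with
  | zero => exact hn
  | succ n ih =>
    refine ih ?_
    have h1 : cmtr (1 : G) f = 1 := by simp [cmtr]
    rw [← h1]
    refine cmtr_injOn hO hf hfO (engel_mem_of_mem_normalizer hfO he n) O.one_mem ?_
    rw [h1, h1]
    exact hn

theorem conj_twist_injOn_of_normal [Finite G] {p : ℕ} [Fact p.Prime] {O : Subgroup G} [O.Normal]
    (hO : IsPGroup p O) {f a b : G} (ha : a ∈ O) (hb : b ∈ O)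
    (h : a * f * a * (a * f)⁻¹ = b * f * b * (b * f)⁻¹) : a = b := by
  have := hO.isNilpotent
  have hc : a⁻¹ * b ∈ O := O.mul_mem (O.inv_mem ha) hb
  suffices a⁻¹ * b = 1 from inv_mul_eq_one.1 this
  refine eq_one_of_central_descent hc fun N _ hN => ?_
  obtain ⟨c, rfl⟩ : ∃ c, b = a * c := ⟨a⁻¹ * b, by group⟩
  have hN' : ∀ g o : G, o ∈ O → Commute ((g * c * g⁻¹ : G) : G ⧸ N) (o : G ⧸ N) := by
    simpa using hN
  have hcO : c ∈ O := by simpa using hc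
  rw [inv_mul_cancel_left, ← QuotientGroup.eq_one_iff]
  have h1 : a * f * a * (a * f)⁻¹ = a * (c * (f * a * f⁻¹ * (f * c * f⁻¹)) * c⁻¹) * a⁻¹ := by
    rw [h]; group
  have h2 : f * a * f⁻¹ = c * (f * a * f⁻¹ * (f * c * f⁻¹)) * c⁻¹ := by
    have : a * (f * a * f⁻¹) * a⁻¹ = a * (c * (f * a * f⁻¹ * (f * c * f⁻¹)) * c⁻¹) * a⁻¹ := by
      rw [← h1]; group
    exact mul_left_cancel (mul_right_cancel this)
  have hcomm : Commute (c : G ⧸ N) ((f * a * f⁻¹ * (f * c * f⁻¹) : G) : G ⧸ N) := by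
    simpa using hN' 1 _ (O.mul_mem (‹O.Normal›.conj_mem a ha f) (‹O.Normal›.conj_mem c hcO f))
  have h3 : ((f * a * f⁻¹ : G) : G ⧸ N) = ((f * a * f⁻¹ : G) : G ⧸ N) * ((f * c * f⁻¹ : G) : G ⧸ N) := by
    conv_lhs => rw [h2, QuotientGroup.mk_mul, QuotientGroup.mk_mul, hcomm.eq, QuotientGroup.mk_inv,
      mul_inv_cancel_right]
    rw [← QuotientGroup.mk_mul]
  have h4 : ((f * c * f⁻¹ : G) : G ⧸ N) = 1 := by simpa using h3.symm
  rw [QuotientGroup.eq_one_iff] at h4 ⊢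
  simpa [mul_assoc] using ‹N.Normal›.conj_mem _ h4 f⁻¹

theorem conj_twist_injOn [Finite G] {p : ℕ} [Fact p.Prime] {O : Subgroup G}
    (hO : IsPGroup p O) {f : G} (hfO : f ∈ Subgroup.normalizer (O : Set G)) {a b : G}
    (ha : a ∈ O) (hb : b ∈ O)
    (h : a * f * a * (a * f)⁻¹ = b * f * b * (b * f)⁻¹) : a = b := by
  let K := Subgroup.normalizer (O : Set G)
  have hle : O ≤ K := Subgroup.le_normalizer
  have := conj_twist_injOn_of_normal (G := K) (O := O.subgroupOf K)
    (hO.comap_of_injective K.subtype K.subtype_injective) (f := ⟨f, hfO⟩)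
    (a := ⟨a, hle ha⟩) (b := ⟨b, hle hb⟩)
    (by simpa [Subgroup.mem_subgroupOf] using ha) (by simpa [Subgroup.mem_subgroupOf] using hb)
    (by ext; simpa using h)
  simpa using this

/-- If elements of `S` with equal images under `φ` differ by an element of `K`, then `K` has index
at most the number of images. -/
theorem relIndex_le_of_fibers [Finite G] {α : Type*} {S K : Subgroup G} (φ : G → α) {A : Set α}
    (hA : A.Finite) (hSA : ∀ x ∈ S, φ x ∈ A)
    (h : ∀ x ∈ S, ∀ y ∈ S, φ x = φ y → x⁻¹ * y ∈ K) : K.relIndex S ≤ A.ncard := by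
  have := hA.to_subtype
  rw [Subgroup.relIndex, Subgroup.index, ← Nat.card_coe_set_eq]
  refine Nat.card_le_card_of_injective
    (fun q : S ⧸ K.subgroupOf S => (⟨φ q.out, hSA _ q.out.2⟩ : A)) fun q q' hq => ?_
  rw [← q.out_eq', ← q'.out_eq', QuotientGroup.eq, Subgroup.mem_subgroupOf]
  exact h _ q.out.2 _ q'.out.2 (congrArg Subtype.val hq)

theorem relIndex_centralizer_le [Finite G] {p m : ℕ} [Fact p.Prime] (hG : SinksLE G m)
    {O S : Subgroup G} (hO : IsPGroup p O) (hS : S ≤ O) {f : G} (hf : p.Coprime (orderOf f))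
    (hfO : f ∈ Subgroup.normalizer (O : Set G)) : (Subgroup.centralizer {f}).relIndex S ≤ m := by
  let Θ : Set G := (fun w => cmtr w f) '' O
  have hΘO : ∀ a ∈ Θ, a ∈ O := by
    rintro _ ⟨w, hw, rfl⟩
    exact cmtr_mem_of_mem_normalizer hfO hw
  have hper : ∀ a ∈ Θ, ∃ k, 0 < k ∧ engel a f k = a := by
    intro a haΘ
    obtain ⟨N, k, hk, h⟩ := engel_eventually_periodic a f
    refine ⟨k, hk, ?_⟩
    replace h := h N le_rfl
    rw [← engel_add] at h
    have hmem : ∀ n, engel a f n ∈ Θ := by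
      intro n
      cases n with
      | zero => exact haΘ
      | succ n => exact ⟨_, engel_mem_of_mem_normalizer hfO (hΘO a haΘ) n, rfl⟩
    induction N with
    | zero => simpa using h
    | succ N ih =>
      refine ih ?_
      obtain ⟨w, hw, hw'⟩ := hmem (N + k)
      obtain ⟨v, hv, hv'⟩ := hmem N
      rw [show N + 1 + k = N + k + 1 by omega, engel_succ, engel_succ, ← hw', ← hv'] at h
      rw [← hw', ← hv']
      exact cmtr_injOn hO hf hfO hw hv h
  have hcard : Θ.ncard ≤ m := by
    refine le_trans ?_ (hG f⁻¹)
    refine Set.ncard_le_ncard_of_injOn (fun a => a * f * a * (a * f)⁻¹) ?_ ?_ (Set.toFinite _)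
    · intro a haΘ
      obtain ⟨k, hk, hka⟩ := hper a haΘ
      have hx : a * f * f * (a * f)⁻¹ = a * f * a⁻¹ := by group
      refine ⟨a * f * f * (a * f)⁻¹, ⟨2 * k - 2 + 1, ?_⟩, k, hk, by rw [engel_conj, hka]⟩
      have h1 := engel_mul_period hka 2
      rw [show k * 2 = 2 * k - 2 + 2 by omega, engel_heineken] at h1
      rw [hx]
      generalize engel f⁻¹ (a * f * a⁻¹) (2 * k - 2 + 1) = y at h1 ⊢
      calc y = a * f * ((a * f)⁻¹ * y * (a * f)) * (a * f)⁻¹ := by group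
        _ = _ := by rw [h1]
    · intro a ha b hb hab
      exact conj_twist_injOn hO hfO (hΘO a ha) (hΘO b hb) hab
  refine le_trans (relIndex_le_of_fibers (fun w => cmtr w⁻¹ f) (Set.toFinite Θ)
    (fun x hx => ⟨x⁻¹, inv_mem (hS hx), rfl⟩) fun x _ y _ hxy => ?_) hcard
  have h1 : x⁻¹⁻¹ * f⁻¹ * x⁻¹ = y⁻¹⁻¹ * f⁻¹ * y⁻¹ := mul_right_cancel hxy
  rw [Subgroup.mem_centralizer_singleton_iff, ← commute_iff_eq, ← Commute.inv_right_iff,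
    commute_iff_eq, ← mul_inv_eq_iff_eq_mul]
  calc x⁻¹ * y * f⁻¹ * (x⁻¹ * y)⁻¹ = x⁻¹ * (y⁻¹⁻¹ * f⁻¹ * y⁻¹) * x := by group
    _ = f⁻¹ := by rw [← h1]; group

end CoprimeAction

section Zipper

open Subgroup

variable {G : Type*} [Group G] {p : ℕ}

theorem mem_smul_sylow {P : Sylow p G} {g x : G} :
    x ∈ ((g • P : Sylow p G) : Subgroup G) ↔ g⁻¹ * x * g ∈ (P : Subgroup G) := by
  rw [Sylow.smul_def]
  exact Subgroup.mem_pointwise_smul_iff_inv_smul_mem.trans (by simp)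

theorem exists_le_smul_of_le [Finite G] [Fact p.Prime] {P : Sylow p G} {K W : Subgroup G}
    (hP : (P : Subgroup G) ≤ K) (hW : W ≤ K) (hWp : IsPGroup p W) :
    ∃ k ∈ K, W ≤ ((k • P : Sylow p G) : Subgroup G) := by
  obtain ⟨Q, hQ⟩ := (hWp.comap_of_injective K.subtype K.subtype_injective).exists_le_sylow
  obtain ⟨k, rfl⟩ := MulAction.exists_smul_eq K (P.subtype hP) Q
  refine ⟨k, k.2, fun x hx => ?_⟩
  have h1 : (⟨x, hW hx⟩ : K) ∈ ((k • P.subtype hP : Sylow p K) : Subgroup K) :=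
    hQ (Subgroup.mem_subgroupOf.2 hx)
  rw [mem_smul_sylow] at h1 ⊢
  simpa [Subgroup.mem_subgroupOf] using h1

/-- In a group with an invariant equivalence relation on its Sylow subgroups, a maximal
intersection of inequivalent Sylow subgroups absorbs suitable left Engel elements. -/
theorem mem_of_maximal_intersection [Finite G] [Fact p.Prime] {T : Set G}
    (hT : ∀ g, ∀ t ∈ T, g * t * g⁻¹ ∈ T) {R : Sylow p G → Sylow p G → Prop}
    (hR : Equivalence R) (hinv : ∀ (g : G) P Q, R P Q → R (g • P) (g • Q)) {P₁ P₂ : Sylow p G}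
    (h12 : ¬ R P₁ P₂)
    (hmax : ∀ P P' : Sylow p G, ¬ R P P' →
      (T ∩ (P : Subgroup G) ∩ (P' : Subgroup G) : Set G).ncard ≤
        (T ∩ (P₁ : Subgroup G) ∩ (P₂ : Subgroup G) : Set G).ncard)
    {u v : G} (huT : u ∈ T) (hu : u ∈ (P₁ : Subgroup G))
    (hun : u ∈ normalizer (T ∩ (P₁ : Subgroup G) ∩ (P₂ : Subgroup G) : Set G))
    (hvT : v ∈ T) (hv : v ∈ (P₂ : Subgroup G)) (hv1 : v ∉ (P₁ : Subgroup G))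
    (hvn : v ∈ normalizer (T ∩ (P₁ : Subgroup G) ∩ (P₂ : Subgroup G) : Set G))
    (hE : ∀ g : G, ¬ R (g • P₁) P₁ → Eng g u) : u ∈ (P₂ : Subgroup G) := by
  set I : Set G := T ∩ (P₁ : Subgroup G) ∩ (P₂ : Subgroup G) with hI
  let K : Subgroup G :=
    { carrier := {g | R (g • P₁) P₁}
      mul_mem' := fun {a b} ha hb => by
        have := hinv a _ _ hb
        rw [smul_smul] at this
        exact hR.trans this ha
      one_mem' := by simpa using hR.refl P₁
      inv_mem' := fun {a} ha => by
        have := hinv a⁻¹ _ _ ha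
        rw [inv_smul_smul] at this
        exact hR.symm this }
  have hK : ∀ g, g ∈ K ↔ R (g • P₁) P₁ := fun _ => Iff.rfl
  have hPK : (P₁ : Subgroup G) ≤ K := fun g hg => by
    rw [hK, Sylow.smul_eq_iff_mem_normalizer.2 (le_normalizer hg)]
    exact hR.refl _
  have hIP1 : I ⊆ (P₁ : Subgroup G) := fun x hx => hx.1.2
  have hIP2 : I ⊆ (P₂ : Subgroup G) := fun x hx => hx.2
  -- an element of `T ∩ K` in an inequivalent Sylow subgroup containing `I` lies in `I`
  have key : ∀ (Q : Sylow p G), (∀ k ∈ K, ¬ R (k • P₁) Q) → I ⊆ (Q : Subgroup G) →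
      ∀ x ∈ T, x ∈ (Q : Subgroup G) → x ∈ K → x ∈ I := by
    intro Q hQ hIQ x hxT hxQ hxK
    have hWQ : closure (insert x I) ≤ (Q : Subgroup G) := by
      rw [closure_le]; exact Set.insert_subset hxQ hIQ
    have hWK : closure (insert x I) ≤ K := by
      rw [closure_le]; exact Set.insert_subset hxK (hIP1.trans hPK)
    obtain ⟨k, hk, hW⟩ := exists_le_smul_of_le hPK hWK (Q.isPGroup'.to_le hWQ)
    have hsub : I ⊆ T ∩ ((k • P₁ : Sylow p G) : Subgroup G) ∩ (Q : Subgroup G) := fun y hy =>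
      ⟨⟨hy.1.1, hW (subset_closure (Set.mem_insert_of_mem _ hy))⟩, hIQ hy⟩
    rw [Set.eq_of_subset_of_ncard_le hsub (hmax _ _ (hQ k hk))]
    exact ⟨⟨hxT, hW (subset_closure (Set.mem_insert _ _))⟩, hxQ⟩
  have hvK : v ∉ K := fun h => hv1 (hIP1 (key P₂
    (fun k hk h' => h12 (hR.trans (hR.symm ((hK k).1 hk)) h')) hIP2 v hvT hv h))
  classical
  obtain ⟨n, hn⟩ := hE v hvK
  have hex : ∃ n, engel v u n ∈ K := ⟨n, hn ▸ K.one_mem⟩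
  obtain ⟨l, hl⟩ := Nat.exists_eq_succ_of_ne_zero
    (n := Nat.find hex) (fun h0 => hvK (by simpa [h0] using Nat.find_spec hex))
  have hg : engel v u l ∉ K := Nat.find_min hex (by omega)
  have hg' : engel v u (l + 1) ∈ K := by rw [← Nat.succ_eq_add_one, ← hl]; exact Nat.find_spec hex
  have hgn : engel v u l ∈ normalizer I := engel_mem hvn hun l
  rw [engel_succ] at hg'
  generalize engel v u l = g at hg hg' hgn
  have hug : g⁻¹ * u * g ∈ K := by
    rw [← inv_mem_iff]
    have := K.mul_mem hg' (K.inv_mem (hPK hu))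
    simpa [cmtr, mul_assoc] using this
  have hconj : ∀ x, x ∈ I ↔ g * x * g⁻¹ ∈ I := mem_set_normalizer_iff.1 hgn
  have hugI : g⁻¹ * u * g ∈ I := by
    refine key (g⁻¹ • P₁) (fun k hk h' => hg ?_) (fun x hx => ?_) _ ?_ ?_ hug
    · rw [← inv_mem_iff, hK]
      exact hR.trans (hR.symm h') hk
    · rw [SetLike.mem_coe, mem_smul_sylow, inv_inv]
      exact hIP1 ((hconj x).1 hx)
    · simpa using hT g⁻¹ u huT
    · rw [mem_smul_sylow]
      simpa [mul_assoc] using hu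
  rw [hconj] at hugI
  refine hIP2 ?_
  simpa [mul_assoc] using hugI

/-- Normalizer growth for normal subsets of a `p`-subgroup. -/
theorem exists_mem_normalizer_notMem [Finite G] [Fact p.Prime] {T : Set G}
    (hT : ∀ g, ∀ t ∈ T, g * t * g⁻¹ ∈ T) {P D : Subgroup G} (hP : IsPGroup p P) (hD : D ≤ P)
    (h : ∃ t ∈ T, t ∈ P ∧ t ∉ D) :
    ∃ u ∈ T, u ∈ P ∧ u ∉ D ∧ u ∈ normalizer (T ∩ D) := by
  obtain ⟨M, hM⟩ : ∃ M, Maximal (fun M : Subgroup G => D ≤ M ∧ M ≤ P ∧ T ∩ M ⊆ D) M :=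
    Set.Finite.exists_maximal (Set.toFinite {M : Subgroup G | D ≤ M ∧ M ≤ P ∧ T ∩ M ⊆ D})
      ⟨D, le_rfl, hD, Set.inter_subset_right⟩
  obtain ⟨⟨hDM, hMP, hTM⟩, hmax⟩ := hM
  have heq : T ∩ D = T ∩ M :=
    (Set.inter_subset_inter_right _ hDM).antisymm (Set.subset_inter Set.inter_subset_left hTM)
  have hlt : M < P := lt_of_le_of_ne hMP fun h' => by
    obtain ⟨t, htT, htP, htD⟩ := h
    exact htD (hTM ⟨htT, h' ▸ htP⟩)
  have := hP.isNilpotent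
  have hgrow : ∃ y ∈ P, y ∈ normalizer (M : Set G) ∧ y ∉ M := by
    have h1 := Group.normalizerCondition_of_isNilpotent (M.subgroupOf P)
      (lt_top_iff_ne_top.2 fun h' => hlt.not_ge (subgroupOf_eq_top.1 h'))
    obtain ⟨y, hy, hy'⟩ := SetLike.exists_of_lt h1
    refine ⟨y, y.2, ?_, fun h => hy' (mem_subgroupOf.2 h)⟩
    rw [← subgroupOf_normalizer_eq hMP] at hy
    exact mem_subgroupOf.1 hy
  obtain ⟨y, hyP, hyN, hyM⟩ := hgrow
  have hN : ¬ (T ∩ ((normalizer (M : Set G) ⊓ P : Subgroup G) : Set G) ⊆ D) := fun hc =>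
    hyM (hmax (y := normalizer (M : Set G) ⊓ P)
      ⟨hDM.trans (le_inf le_normalizer hMP), inf_le_right, hc⟩
      (le_inf le_normalizer hMP) ⟨hyN, hyP⟩)
  obtain ⟨u, ⟨huT, huN, huP⟩, huD⟩ := Set.not_subset.1 hN
  refine ⟨u, huT, huP, huD, ?_⟩
  rw [heq, mem_set_normalizer_iff]
  intro x
  have h1 := mem_normalizer_iff.1 huN x
  refine ⟨fun hx => ⟨hT _ _ hx.1, h1.1 hx.2⟩, fun hx => ⟨?_, h1.2 hx.2⟩⟩
  simpa [mul_assoc] using hT u⁻¹ _ hx.1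

theorem exists_maximal_inter [Finite G] [Fact p.Prime] (T : Set G)
    {R : Sylow p G → Sylow p G → Prop} (h : ¬ ∀ P Q, R P Q) :
    ∃ P₁ P₂, ¬ R P₁ P₂ ∧ ∀ P P' : Sylow p G, ¬ R P P' →
      (T ∩ (P : Subgroup G) ∩ (P' : Subgroup G) : Set G).ncard ≤
        (T ∩ (P₁ : Subgroup G) ∩ (P₂ : Subgroup G) : Set G).ncard := by
  push Not at h
  obtain ⟨P, Q, hPQ⟩ := h
  have : Nonempty {x : Sylow p G × Sylow p G // ¬ R x.1 x.2} := ⟨⟨(P, Q), hPQ⟩⟩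
  obtain ⟨⟨⟨P₁, P₂⟩, h⟩, hmax⟩ := Finite.exists_max
    (fun x : {x : Sylow p G × Sylow p G // ¬ R x.1 x.2} =>
      (T ∩ (x.1.1 : Subgroup G) ∩ (x.1.2 : Subgroup G) : Set G).ncard)
  exact ⟨P₁, P₂, h, fun P P' hP => hmax ⟨(P, P'), hP⟩⟩

/-- **Baer's theorem**: a left Engel `p`-element of a finite group lies in a normal `p`-subgroup. -/
theorem isPGroup_normalClosure_of_eng [Finite G] [Fact p.Prime] {e : G}
    (he : IsPGroup p (zpowers e)) (h : ∀ g, Eng g e) : IsPGroup p (normalClosure {e}) := by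
  let T : Set G := {x | ∃ g, x = g * e * g⁻¹}
  have hT : ∀ g, ∀ t ∈ T, g * t * g⁻¹ ∈ T := by
    rintro g _ ⟨a, rfl⟩
    exact ⟨g * a, by group⟩
  have hTE : ∀ t ∈ T, ∀ g, Eng g t := by
    rintro _ ⟨a, rfl⟩ g
    have := (h (a⁻¹ * g * a)).conj a
    simpa [mul_assoc] using this
  let R : Sylow p G → Sylow p G → Prop := fun P Q =>
    T ∩ (P : Subgroup G) = T ∩ (Q : Subgroup G)
  have hR : Equivalence R := ⟨fun _ => rfl, fun h => h.symm, fun h h' => h.trans h'⟩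
  have hsmul : ∀ (g x : G) (P : Sylow p G),
      x ∈ T ∩ ((g • P : Sylow p G) : Subgroup G) ↔ g⁻¹ * x * g ∈ T ∩ (P : Subgroup G) := by
    intro g x P
    refine and_congr ⟨fun hx => by simpa using hT g⁻¹ x hx, fun hx => ?_⟩ mem_smul_sylow
    simpa [mul_assoc] using hT g _ hx
  have hinv : ∀ (g : G) (P Q : Sylow p G), R P Q → R (g • P) (g • Q) := by
    intro g P Q hPQ
    ext x
    rw [hsmul, hsmul, hPQ]
  have hcard : ∀ P Q : Sylow p G, (T ∩ (P : Subgroup G) : Set G).ncard =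
      (T ∩ (Q : Subgroup G) : Set G).ncard := by
    intro P Q
    obtain ⟨g, rfl⟩ := MulAction.exists_smul_eq G P Q
    rw [← Set.ncard_image_of_injective _ (MulAut.conj g).injective]
    congr 1
    ext x
    rw [hsmul]
    constructor
    · rintro ⟨y, hy, rfl⟩
      simpa [mul_assoc] using hy
    · intro hx
      exact ⟨_, hx, by simp [mul_assoc]⟩
  have hall : ∀ P Q, R P Q := by
    by_contra hcon
    obtain ⟨P₁, P₂, h12, hmax⟩ := exists_maximal_inter T hcon
    have hex : ∀ P Q : Sylow p G, ¬ R P Q → ∃ t ∈ T, t ∈ (P : Subgroup G) ∧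
        t ∉ (P ⊓ Q : Subgroup G) := by
      intro P Q hPQ
      by_contra! hcon
      exact hPQ (Set.eq_of_subset_of_ncard_le
        (fun x hx => ⟨hx.1, (hcon x hx.1 hx.2).2⟩) (hcard Q P).le)
    obtain ⟨u, huT, hu1, hu2, hun⟩ :=
      exists_mem_normalizer_notMem hT P₁.isPGroup' inf_le_left (hex _ _ h12)
    obtain ⟨v, hvT, hv2, hv1, hvn⟩ :=
      exists_mem_normalizer_notMem hT P₂.isPGroup' inf_le_left (hex _ _ fun h' => h12 h'.symm)
    rw [coe_inf, ← Set.inter_assoc] at hun hvn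
    rw [Set.inter_right_comm] at hvn
    exact hu2 ⟨hu1, mem_of_maximal_intersection hT hR hinv h12 hmax huT hu1 hun hvT hv2
      (fun h' => hv1 ⟨hv2, h'⟩) hvn fun g _ => hTE u huT g⟩
  obtain ⟨P, hP⟩ := he.exists_le_sylow
  have hle : normalClosure {e} ≤ (P : Subgroup G) := by
    refine closure_le _ |>.2 ?_
    intro x hx
    obtain ⟨y, hy, hyx⟩ := Group.mem_conjugatesOfSet_iff.1 hx
    rw [Set.mem_singleton_iff.1 hy] at hyx
    obtain ⟨g, rfl⟩ := isConj_iff.1 hyx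
    have h1 : e ∈ T ∩ ((g⁻¹ • P : Sylow p G) : Subgroup G) := by
      rw [hall _ P]
      exact ⟨⟨1, by simp⟩, hP (mem_zpowers e)⟩
    simpa using ((hsmul _ _ _).1 h1).2
  exact P.isPGroup'.to_le hle

/-- A right Engel `p`-element of a finite group lies in a normal `p`-subgroup. -/
theorem isPGroup_normalClosure_of_right_eng [Finite G] [Fact p.Prime] {e : G}
    (he : IsPGroup p (zpowers e)) (h : ∀ x, Eng e x) : IsPGroup p (normalClosure {e}) := by
  have h1 := isPGroup_normalClosure_of_eng (p := p) (e := e⁻¹) (by rwa [zpowers_inv]) fun g => by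
    rw [eng_heineken, inv_inv]
    exact h _
  refine h1.to_le (normalClosure_le_normal ?_)
  rw [Set.singleton_subset_iff, SetLike.mem_coe, ← inv_mem_iff]
  exact subset_normalClosure rfl

theorem isPGroup_zpowers_of_mem {P : Subgroup G} (hP : IsPGroup p P) {e : G} (he : e ∈ P) :
    IsPGroup p (zpowers e) :=
  hP.to_le (zpowers_le.2 he)

theorem eng_of_isPGroup [Finite G] [Fact p.Prime] {P : Subgroup G} (hP : IsPGroup p P) {a b : G}
    (ha : a ∈ P) (hb : b ∈ P) : Eng a b := by
  have := hP.isNilpotent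
  obtain ⟨n, hn⟩ := eng_of_isNilpotent (⟨a, ha⟩ : P) ⟨b, hb⟩
  exact ⟨n, by simpa using (engel_coe _ _ n).symm.trans (congrArg Subtype.val hn)⟩

theorem isPGroup_normalClosure_of_pairs [Finite G] [Fact p.Prime] {e : G}
    (h : ∀ g, ∃ W : Subgroup G, IsPGroup p W ∧ e ∈ W ∧ g * e * g⁻¹ ∈ W) :
    IsPGroup p (normalClosure {e}) := by
  obtain ⟨W, hW, heW, -⟩ := h 1
  refine isPGroup_normalClosure_of_eng (isPGroup_zpowers_of_mem hW heW) fun g => ?_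
  obtain ⟨W, hW, heW, hgW⟩ := h g⁻¹
  have h1 : cmtr g e ∈ W := by
    have := W.mul_mem (W.inv_mem hgW) heW
    simpa [cmtr, mul_assoc] using this
  obtain ⟨n, hn⟩ := eng_of_isPGroup hW h1 heW
  exact ⟨1 + n, by rw [engel_add]; exact hn⟩

end Zipper

section PCore

open Subgroup

variable {G : Type*} [Group G] {p : ℕ}

/-- The largest normal `p`-subgroup of a subgroup `H`, as a subgroup of the ambient group. -/
def pcore (p : ℕ) (H : Subgroup G) : Subgroup G :=
  sSup {N | N ≤ H ∧ H ≤ normalizer (N : Set G) ∧ IsPGroup p N}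

theorem le_pcore {H N : Subgroup G} (h1 : N ≤ H) (h2 : H ≤ normalizer (N : Set G))
    (h3 : IsPGroup p N) : N ≤ pcore p H :=
  le_sSup ⟨h1, h2, h3⟩

theorem pcore_le (H : Subgroup G) : pcore p H ≤ H := sSup_le fun _ h => h.1

theorem mem_normalizer_pcore {H : Subgroup G} {k : G} (hk : k ∈ normalizer (H : Set G)) :
    k ∈ normalizer (pcore p H : Set G) := by
  have key : ∀ k ∈ normalizer (H : Set G), (pcore p H).map (MulAut.conj k).toMonoidHom ≤
      pcore p H := by
    intro k hk
    rw [pcore, (gc_map_comap _).l_sSup]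
    refine iSup₂_le fun N hN => le_pcore ?_ ?_ (hN.2.2.map _)
    · conv_rhs => rw [← mem_normalizer_iff_map_conj_eq.1 hk]
      exact map_mono hN.1
    · conv_lhs => rw [← mem_normalizer_iff_map_conj_eq.1 hk]
      exact (map_mono hN.2.1).trans (le_normalizer_map _)
  rw [mem_normalizer_iff]
  intro x
  refine ⟨fun hx => key k hk ⟨x, hx, rfl⟩, fun hx => ?_⟩
  simpa [mul_assoc] using key k⁻¹ (inv_mem hk) ⟨_, hx, rfl⟩

theorem le_normalizer_pcore (H : Subgroup G) : H ≤ normalizer (pcore p H : Set G) :=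
  le_normalizer.trans fun _ => mem_normalizer_pcore

theorem isPGroup_pcore [Finite G] (H : Subgroup G) : IsPGroup p (pcore p H) := by
  let S : Set (Subgroup G) := {N | N ≤ H ∧ H ≤ normalizer (N : Set G) ∧ IsPGroup p N}
  have hbot : (⊥ : Subgroup G) ∈ S :=
    ⟨bot_le, normalizer_eq_top (⊥ : Subgroup G) ▸ le_top, IsPGroup.of_bot⟩
  obtain ⟨N, hN⟩ := Set.Finite.exists_maximal (Set.toFinite S) ⟨_, hbot⟩
  have hsup : ∀ M ∈ S, M ≤ N := by
    intro M hM
    have hmem : N ⊔ M ∈ S := by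
      refine ⟨sup_le hN.prop.1 hM.1, ?_, hN.prop.2.2.to_sup_of_normal_left' hM.2.2
        (hM.1.trans hN.prop.2.1)⟩
      intro h hh
      rw [mem_normalizer_iff_map_conj_eq, Subgroup.map_sup,
        mem_normalizer_iff_map_conj_eq.1 (hN.prop.2.1 hh),
        mem_normalizer_iff_map_conj_eq.1 (hM.2.1 hh)]
    exact le_sup_right.trans (hN.le_of_ge hmem le_sup_left)
  exact hN.prop.2.2.to_le (sSup_le hsup)

theorem pcore_inf_le [Finite G] {H K : Subgroup G} (h : K ≤ H) : pcore p H ⊓ K ≤ pcore p K := by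
  refine le_pcore inf_le_right (fun k hk => ?_) ((isPGroup_pcore H).to_le inf_le_left)
  have h1 := mem_normalizer_iff.1 (le_normalizer_pcore (p := p) H (h hk))
  rw [mem_normalizer_iff]
  intro x
  exact and_congr (h1 x) (mem_normalizer_iff.1 (le_normalizer hk) x)

/-- The group `H` is `p`-bounded with constant `c`: its `p`-subgroups have index at most `c` over
their intersection with the `p`-core. -/
def PBdd (p c : ℕ) (H : Subgroup G) : Prop :=
  ∀ S : Subgroup G, S ≤ H → IsPGroup p S → (pcore p H).relIndex S ≤ c

theorem relIndex_anti_left [Finite G] {H K L : Subgroup G} (h : H ≤ K) :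
    K.relIndex L ≤ H.relIndex L :=
  relIndex_le_of_le_left h index_ne_zero_of_finite

theorem relIndex_mono_right [Finite G] {H K L : Subgroup G} (h : K ≤ L) :
    H.relIndex K ≤ H.relIndex L :=
  relIndex_le_of_le_right h index_ne_zero_of_finite

theorem PBdd.mono [Finite G] {c : ℕ} {H K : Subgroup G} (hH : PBdd p c H) (h : K ≤ H) :
    PBdd p c K := fun S hS hSp => by
  refine le_trans ?_ (hH S (hS.trans h) hSp)
  rw [← inf_relIndex_right (pcore p H)]
  exact relIndex_anti_left ((inf_le_inf_left _ hS).trans (pcore_inf_le h))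

theorem relIndex_trans [Finite G] {A S P : Subgroup G} {a s : ℕ} (hA : A.relIndex S ≤ a)
    (hS : S.relIndex P ≤ s) : A.relIndex P ≤ a * s := by
  calc A.relIndex P ≤ (A ⊓ S).relIndex P := relIndex_anti_left inf_le_left
    _ = A.relIndex (S ⊓ P) * S.relIndex P := (relIndex_inf_mul_relIndex ..).symm
    _ ≤ a * s := Nat.mul_le_mul ((relIndex_mono_right inf_le_left).trans hA) hS

theorem relIndex_inf_le_mul [Finite G] {A B P : Subgroup G} {a b : ℕ} (hA : A.relIndex P ≤ a)
    (hB : B.relIndex P ≤ b) : (A ⊓ B).relIndex P ≤ a * b :=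
  relIndex_inf_le.trans (Nat.mul_le_mul hA hB)

theorem card_eq_relIndex_mul (A P : Subgroup G) :
    Nat.card P = A.relIndex P * Nat.card (A ⊓ P : Subgroup G) := by
  rw [← relIndex_bot_left (A ⊓ P), ← relIndex_bot_left P, mul_comm, ← inf_relIndex_right A P,
    relIndex_mul_relIndex _ _ _ bot_le inf_le_right]

/-- A subgroup of index less than the order meets nontrivially. -/
theorem exists_ne_one_of_relIndex_lt {A P : Subgroup G} {a : ℕ} (hA : A.relIndex P ≤ a)
    (ha : a < Nat.card P) : ∃ x ∈ P, x ∈ A ∧ x ≠ 1 := by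
  by_contra! hcon
  have h1 : A ⊓ P = ⊥ := (eq_bot_iff_forall _).2 fun x hx => hcon x hx.2 hx.1
  have h2 := card_eq_relIndex_mul A P
  rw [h1, Subgroup.card_bot, mul_one] at h2
  omega

end PCore

section Local

open Subgroup

variable {G : Type*} [Group G] {p m c w : ℕ}

/-- The standing hypotheses on a group with bounded right Engel sinks and trivial `p`-core. -/
structure BoundedSinks (p m c w : ℕ) (G : Type*) [Group G] : Prop where
  sinks : SinksLE G m
  core : ∀ N : Subgroup G, N.Normal → IsPGroup p N → N = ⊥
  idx : ∀ (g : G) (S : Subgroup G), S ≤ centralizer {g} →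
    (centralizer (rsink g)).relIndex S ≤ w
  bdd : ∀ g : G, (∃ x, ¬ Eng g x) → PBdd p c (centralizer {g})

theorem mem_centralizer_singleton_comm {a b : G} :
    a ∈ centralizer {b} ↔ b ∈ centralizer {a} := by
  rw [mem_centralizer_singleton_iff, mem_centralizer_singleton_iff]
  exact eq_comm

theorem eq_one_of_isPGroup_normalClosure (hS : BoundedSinks p m c w G) {e : G}
    (he : IsPGroup p (normalClosure {e})) : e = 1 := by
  have h1 := hS.core _ normalClosure_normal he
  have h2 : e ∈ normalClosure {e} := subset_normalClosure rfl
  rwa [h1, mem_bot] at h2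

theorem exists_not_eng [Finite G] [Fact p.Prime] (hS : BoundedSinks p m c w G) {e : G}
    (he : IsPGroup p (zpowers e)) (h1 : e ≠ 1) : ∃ x, ¬ Eng e x := by
  by_contra! hcon
  exact h1 (eq_one_of_isPGroup_normalClosure hS (isPGroup_normalClosure_of_right_eng he hcon))

theorem orderOf_coprime_of_isPGroup {p q : ℕ} (hp : p.Prime) (hq : q.Prime)
    (hpq : p ≠ q) {e : G} (he : IsPGroup p (zpowers e)) : q.Coprime (orderOf e) := by
  obtain ⟨k, hk⟩ := he ⟨e, mem_zpowers e⟩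
  have hk' : e ^ p ^ k = 1 := by simpa using congrArg Subtype.val hk
  exact Nat.Coprime.coprime_dvd_right (orderOf_dvd_of_pow_eq_one hk')
    (Nat.Coprime.pow_right _ ((Nat.coprime_primes hq hp).2 hpq.symm))

theorem isPGroup_zpowers_of_pow_eq_one {q k : ℕ} {e : G} (h : e ^ q ^ k = 1) :
    IsPGroup q (zpowers e) := by
  rintro ⟨x, hx⟩
  obtain ⟨n, rfl⟩ := mem_zpowers_iff.1 hx
  refine ⟨k, Subtype.ext ?_⟩
  rw [coe_pow, coe_one, ← zpow_natCast, ← zpow_mul, mul_comm, zpow_mul, zpow_natCast, h, one_zpow]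

/-- If all elements of `Z` of order coprime to `p` are right Engel, they centralize the
`p`-elements. -/
theorem commute_of_coprime_order [Finite G] [hp : Fact p.Prime] {Z : Subgroup G}
    (h : ∀ f ∈ Z, p.Coprime (orderOf f) → ∀ x, Eng f x) {e : G} (he : IsPGroup p (zpowers e))
    (n : ℕ) : p.Coprime n → ∀ f ∈ Z, f ^ n = 1 → Commute f e := by
  induction n using Nat.recOnPosPrimePosCoprime with
  | prime_pow q k hq hk =>
    intro hpn f hf hfn
    have := Fact.mk hq
    have hpq : p ≠ q := by
      rintro rfl
      exact hp.1.ne_one ((Nat.coprime_self p).1 (Nat.Coprime.coprime_dvd_right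
        (dvd_pow_self p hk.ne') hpn))
    have hcop := Nat.Coprime.coprime_dvd_right (orderOf_dvd_of_pow_eq_one hfn) hpn
    have hfq := isPGroup_zpowers_of_pow_eq_one hfn
    exact commute_of_eng (isPGroup_normalClosure_of_right_eng hfq (h f hf hcop))
      (orderOf_coprime_of_isPGroup hp.1 hq hpq he)
      (normalizer_eq_top (normalClosure {f}) ▸ mem_top e)
      (subset_normalClosure rfl) (h f hf hcop e)
  | zero => exact fun h0 => absurd ((Nat.coprime_zero_right p).1 h0) hp.1.ne_one
  | one => intro _ f _ hf; rw [pow_one] at hf; rw [hf]; exact Commute.one_left e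
  | coprime a b ha hb hab iha ihb =>
    intro hpn f hf hfn
    have h1 := ihb (Nat.Coprime.coprime_mul_left_right hpn) (f ^ a) (pow_mem hf a)
      (by rw [← pow_mul, hfn])
    have h2 := iha (Nat.Coprime.coprime_mul_right_right hpn) (f ^ b) (pow_mem hf b)
      (by rw [← pow_mul, mul_comm, hfn])
    have h3 := Nat.gcd_eq_gcd_ab a b
    rw [hab] at h3
    have : f = (f ^ a) ^ (a.gcdA b) * (f ^ b) ^ (a.gcdB b) := by
      rw [← zpow_natCast f a, ← zpow_natCast f b, ← zpow_mul, ← zpow_mul, ← zpow_add, ← h3]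
      simp
    rw [this]
    exact (h1.zpow_left _).mul_left (h2.zpow_left _)

theorem exists_coprime_not_eng [Finite G] [hp : Fact p.Prime] (hS : BoundedSinks p m c w G) {e : G}
    (he : IsPGroup p (zpowers e)) (h1 : e ≠ 1) :
    ∃ f ∈ closure (rsink e), p.Coprime (orderOf f) ∧ ∃ x, ¬ Eng f x := by
  obtain ⟨g, hg⟩ : ∃ g, ¬ Eng g e⁻¹ := by
    by_contra! hcon
    have := eq_one_of_isPGroup_normalClosure hS
      (isPGroup_normalClosure_of_eng (by rwa [zpowers_inv]) hcon)
    exact h1 (inv_eq_one.1 this)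
  rw [eng_heineken, inv_inv] at hg
  set d := g * e⁻¹ * g⁻¹ with hd
  have hdp : IsPGroup p (zpowers d) := by
    obtain ⟨k, hk⟩ := he ⟨e, mem_zpowers e⟩
    have hk' : e ^ p ^ k = 1 := by simpa using congrArg Subtype.val hk
    refine isPGroup_zpowers_of_pow_eq_one (k := k) ?_
    rw [hd, conj_pow, inv_pow, hk']; group
  obtain ⟨z, hz1, ⟨k, hk, hkz⟩, hzi, -⟩ := exists_periodic_of_not_eng hg
  by_contra! hcon
  let A : Set G := {y | ∃ i, engel z d i = y}
  let Z : Subgroup G := closure A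
  have hZ : Z ≤ closure (rsink e) := closure_mono (by rintro _ ⟨i, rfl⟩; exact hzi i)
  let C : Subgroup G := centralizer {x | IsPGroup p (zpowers x)}
  have hC : ∀ x, x ∈ C ↔ ∀ y, IsPGroup p (zpowers y) → Commute x y := fun x => by
    rw [mem_centralizer_iff]
    exact forall₂_congr fun y _ => eq_comm
  have hconjp : ∀ y, IsPGroup p (zpowers y) → ∀ g : G, IsPGroup p (zpowers (g * y * g⁻¹)) := by
    intro y hy g
    have := hy.map (MulAut.conj g).toMonoidHom
    rwa [MonoidHom.map_zpowers] at this
  have hCn : C.Normal := ⟨fun x hx g => by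
    rw [hC] at hx ⊢
    intro y hy
    have h2 := hx _ (hconjp y hy g⁻¹)
    have h3 := h2.map (MulAut.conj g).toMonoidHom
    simpa [mul_assoc] using h3⟩
  have hcomm : ∀ f ∈ Z, ∀ n, p.Coprime n → f ^ n = 1 → f ∈ C := by
    intro f hf n hn hfn
    rw [hC]
    intro y hy
    exact commute_of_coprime_order (fun f hf hcop => hcon f (hZ hf) hcop) hy n hn f hf hfn
  have hdZ : d⁻¹ ∈ normalizer (Z : Set G) := by
    refine mem_normalizer_fintype fun x hx => ?_
    have : Z ≤ Z.comap (MulAut.conj d⁻¹).toMonoidHom := by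
      rw [closure_le]
      rintro _ ⟨i, rfl⟩
      have h2 : engel z d i * engel z d (i + 1) ∈ Z :=
        Z.mul_mem (subset_closure ⟨i, rfl⟩) (subset_closure ⟨i + 1, rfl⟩)
      rw [engel_succ, cmtr] at h2
      simpa [mul_assoc] using h2
    exact this hx
  have hdZ' : d ∈ normalizer (Z : Set G) := by simpa using inv_mem hdZ
  let π := QuotientGroup.mk' C
  have hZp : IsPGroup p (Z.map π) := by
    rintro ⟨_, y, hy, rfl⟩
    obtain ⟨a, n, hn, hyn⟩ := Nat.exists_eq_pow_mul_and_not_dvd (orderOf_pos y).ne' p hp.1.ne_one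
    refine ⟨a, Subtype.ext ?_⟩
    have h2 : y ^ p ^ a ∈ C := hcomm _ (pow_mem hy _) n ((Nat.Prime.coprime_iff_not_dvd hp.1).2 hn)
      (by rw [← pow_mul, ← hyn, pow_orderOf_eq_one])
    rw [coe_pow, coe_one]
    exact (QuotientGroup.eq_one_iff _).2 h2
  have hdp' : IsPGroup p (zpowers (π d)) := by
    have := hdp.map π
    rwa [MonoidHom.map_zpowers] at this
  have hsup : IsPGroup p (Z.map π ⊔ zpowers (π d) : Subgroup (G ⧸ C)) := by
    refine hZp.to_sup_of_normal_left' hdp' ?_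
    rw [zpowers_le]
    exact le_normalizer_map π ⟨d, hdZ', rfl⟩
  obtain ⟨n, hn⟩ := eng_of_isPGroup hsup
    (mem_sup_left (mem_map_of_mem π (subset_closure ⟨0, rfl⟩ : z ∈ Z)))
    (mem_sup_right (mem_zpowers (π d)))
  rw [← map_engel] at hn
  have h2 : engel z d n ∈ C := (QuotientGroup.eq_one_iff _).1 hn
  exact not_eng_of_periodic hk hkz hz1 ⟨n + 1, cmtr_eq_one_iff.2 ((hC _).1 h2 d hdp)⟩

theorem centralizer_relIndex_le_of_conj_mem [Finite G] {S : Subgroup G} {z : G} {A : Set G} {b : ℕ}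
    (hA : A.ncard ≤ b) (h : ∀ x ∈ S, x * z * x⁻¹ ∈ A) : (centralizer {z}).relIndex S ≤ b := by
  refine (relIndex_le_of_fibers (fun x => x * z * x⁻¹) (Set.toFinite A) h
    fun x _ y _ hxy => ?_).trans hA
  rw [mem_centralizer_singleton_iff]
  have h1 : x⁻¹ * (x * z * x⁻¹) * y = x⁻¹ * (y * z * y⁻¹) * y := by
    have : x * z * x⁻¹ = y * z * y⁻¹ := hxy
    rw [this]
  simpa [mul_assoc] using h1.symm

theorem centralizer_set_relIndex_le [Finite G] {S : Subgroup G} {A : Set G} {b : ℕ} (hb : 0 < b)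
    (hA : A.ncard ≤ b) (h : ∀ x ∈ S, ∀ z ∈ A, x * z * x⁻¹ ∈ A) :
    (centralizer A).relIndex S ≤ b ^ b := by
  classical
  have := Fintype.ofFinite A
  have h1 : centralizer A = ⨅ z : A, centralizer {(z : G)} := by
    ext x
    simp only [mem_iInf, mem_centralizer_iff, Set.mem_singleton_iff, forall_eq, Subtype.forall]
  rw [h1]
  refine (relIndex_iInf_le _).trans ((Finset.prod_le_pow_card _ _ b fun (z : A) _ =>
    centralizer_relIndex_le_of_conj_mem hA fun x hx => h x hx z.1 z.2).trans ?_)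
  refine Nat.pow_le_pow_right hb ?_
  rwa [Finset.card_univ, ← Nat.card_eq_fintype_card, Nat.card_coe_set_eq]

theorem centralizer_rsink_relIndex_le [Finite G] (h : SinksLE G m) (hm : 0 < m) {g : G}
    {S : Subgroup G} (hS : S ≤ centralizer {g}) : (centralizer (rsink g)).relIndex S ≤ m ^ m :=
  centralizer_set_relIndex_le hm (h g) fun _ hx _ hz =>
    conj_mem_rsink_of_commute hz (mem_centralizer_singleton_iff.1 (hS hx))

/-- A finite `p`-group of order exceeding `b` has a subgroup of order exceeding `b` whose
centralizer has bounded index. -/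
theorem exists_large_bounded_centralizer [Finite G] [Fact p.Prime] {P : Subgroup G}
    (hP : IsPGroup p P) {b : ℕ} (hb : 0 < b) (hbP : b < Nat.card P) :
    ∃ J ≤ P, b < Nat.card J ∧ (centralizer (J : Set G)).relIndex P ≤ b ^ b * b := by
  obtain ⟨M, hM⟩ : ∃ M, Maximal (fun M : Subgroup G => M ≤ P ∧ P ≤ normalizer (M : Set G) ∧
      Nat.card M ≤ b) M :=
    Set.Finite.exists_maximal (Set.toFinite {M : Subgroup G | _})
      ⟨⊥, bot_le, normalizer_eq_top (⊥ : Subgroup G) ▸ le_top, by rwa [card_bot]⟩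
  obtain ⟨⟨hMP, hPM, hMb⟩, hmax⟩ := hM
  have hMne : ¬ P ≤ M := fun h => by
    have := card_le_of_le h
    omega
  have hnorm : (M.subgroupOf P).Normal := (normal_subgroupOf_iff_le_normalizer hMP).2 hPM
  have hnontriv : Nontrivial (P ⧸ M.subgroupOf P) :=
    QuotientGroup.nontrivial_iff.2 fun h => hMne (subgroupOf_eq_top.1 h)
  have hcen : Nontrivial (center (P ⧸ M.subgroupOf P)) :=
    (hP.to_quotient (M.subgroupOf P)).center_nontrivial
  obtain ⟨⟨q, hq⟩, hq1⟩ := exists_ne (1 : center (P ⧸ M.subgroupOf P))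
  obtain ⟨⟨j, hjP⟩, rfl⟩ := QuotientGroup.mk_surjective q
  have hjM : j ∉ M := fun h => hq1 (Subtype.ext ((QuotientGroup.eq_one_iff _).2 h))
  have hcent : ∀ x ∈ P, j⁻¹ * (x * j * x⁻¹) ∈ M := by
    intro x hx
    have h1 := mem_center_iff.1 hq ((⟨x, hx⟩ : P) : P ⧸ M.subgroupOf P)
    have h2 : (((⟨j, hjP⟩ : P) : P ⧸ M.subgroupOf P)) = ((⟨x, hx⟩ * ⟨j, hjP⟩ * ⟨x, hx⟩⁻¹ : P) :) := by
      rw [QuotientGroup.mk_mul, QuotientGroup.mk_mul, h1, QuotientGroup.mk_inv, mul_inv_cancel_right]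
    exact mem_subgroupOf.1 (QuotientGroup.eq.1 h2)
  let J : Subgroup G := M ⊔ zpowers j
  have hJP : J ≤ P := sup_le hMP (zpowers_le.2 hjP)
  have hjJ : j ∈ J := mem_sup_right (mem_zpowers j)
  have hPJ : P ≤ normalizer (J : Set G) := by
    intro x hx
    refine mem_normalizer_fintype fun y hy => ?_
    have : J ≤ J.comap (MulAut.conj x).toMonoidHom := by
      refine sup_le (fun y hy => ?_) ((zpowers_le).2 ?_)
      · exact mem_sup_left ((mem_normalizer_iff.1 (hPM hx) y).1 hy)
      · have := J.mul_mem hjJ (mem_sup_left (hcent x hx))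
        simpa [mul_assoc] using this
    exact this hy
  refine ⟨J, hJP, ?_, ?_⟩
  · by_contra! hJb
    exact hjM (hmax (y := J) ⟨hJP, hPJ, hJb⟩ le_sup_left hjJ)
  · have h1 : (centralizer (M : Set G)).relIndex P ≤ b ^ b :=
      centralizer_set_relIndex_le hb (by rwa [← Nat.card_coe_set_eq])
        fun x hx z hz => (mem_normalizer_iff.1 (hPM hx) z).1 hz
    have h2 : (centralizer {j}).relIndex P ≤ b := by
      refine centralizer_relIndex_le_of_conj_mem (A := (j * ·) '' M) ?_ fun x hx =>
        ⟨_, hcent x hx, by group⟩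
      refine (Set.ncard_image_le (Set.toFinite _)).trans ?_
      rwa [← Nat.card_coe_set_eq]
    refine le_trans (relIndex_anti_left ?_) (relIndex_inf_le_mul h1 h2)
    rw [le_centralizer_iff]
    refine sup_le ?_ ?_
    · exact le_centralizer_iff.1 inf_le_left
    · rw [zpowers_le, mem_centralizer_iff]
      exact fun x hx => mem_centralizer_singleton_iff.1 hx.2

end Local

section SylowFusion

open Subgroup

variable {G : Type*} [Group G] {p m c w : ℕ}

theorem isPGroup_zpowers_of_mem_sylow {P : Sylow p G} {e : G} (he : e ∈ (P : Subgroup G)) :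
    IsPGroup p (zpowers e) :=
  isPGroup_zpowers_of_mem P.isPGroup' he

theorem relIndex_le_relIndex_of_card_le [Finite G] {A B : Subgroup G}
    (h : Nat.card A ≤ Nat.card B) : B.relIndex A ≤ A.relIndex B := by
  have h1 := card_eq_relIndex_mul A B
  have h2 := card_eq_relIndex_mul B A
  rw [inf_comm] at h1
  rw [h1, h2] at h
  exact Nat.le_of_mul_le_mul_right h Nat.card_pos

theorem card_sylow_eq [Finite G] [Fact p.Prime] (P Q : Sylow p G) :
    Nat.card (P : Subgroup G) = Nat.card (Q : Subgroup G) := by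
  rw [P.card_eq_multiplicity, Q.card_eq_multiplicity]

theorem card_le_card_sylow [Finite G] [Fact p.Prime] {O : Subgroup G} (hO : IsPGroup p O)
    (P : Sylow p G) : Nat.card O ≤ Nat.card (P : Subgroup G) := by
  obtain ⟨Q, hQ⟩ := hO.exists_le_sylow
  rw [card_sylow_eq P Q]
  exact card_le_of_le hQ

theorem relIndex_sylow_comm [Finite G] [Fact p.Prime] (P Q : Sylow p G) :
    (P : Subgroup G).relIndex Q = (Q : Subgroup G).relIndex P :=
  (relIndex_le_relIndex_of_card_le (card_sylow_eq Q P).le).antisymm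
    (relIndex_le_relIndex_of_card_le (card_sylow_eq P Q).le)

/-- If a `p`-bounded subgroup nearly contains two Sylow subgroups, these have a large
intersection. -/
theorem PBdd.relIndex_sylow_le [Finite G] [Fact p.Prime] {H : Subgroup G} (hH : PBdd p c H)
    {P₁ P₂ : Sylow p G} {s₁ s₂ : ℕ} (h1 : H.relIndex P₁ ≤ s₁) (h2 : H.relIndex P₂ ≤ s₂) :
    (P₁ : Subgroup G).relIndex P₂ ≤ (c * s₁) * (c * s₂) := by
  have key : ∀ (P : Sylow p G) (s : ℕ), H.relIndex P ≤ s →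
      (pcore p H).relIndex P ≤ c * s := fun P s h =>
    relIndex_trans (hH (H ⊓ P) inf_le_left (P.isPGroup'.to_le inf_le_right))
      (by rwa [inf_relIndex_right])
  exact relIndex_trans ((relIndex_le_relIndex_of_card_le
    (card_le_card_sylow (isPGroup_pcore H) P₁)).trans (key P₁ s₁ h1)) (key P₂ s₂ h2)

theorem relIndex_smul_sylow (K : Subgroup G) (g : G) (P : Sylow p G) :
    (K.map (MulAut.conj g).toMonoidHom).relIndex ((g • P : Sylow p G) : Subgroup G) =
      K.relIndex P := by
  rw [Sylow.coe_subgroup_smul]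
  exact relIndex_pointwise_smul (MulAut.conj g) K P

theorem relIndex_smul_smul_sylow (g : G) (P Q : Sylow p G) :
    ((g • P : Sylow p G) : Subgroup G).relIndex ((g • Q : Sylow p G) : Subgroup G) =
      (P : Subgroup G).relIndex Q := by
  rw [Sylow.coe_subgroup_smul, Sylow.coe_subgroup_smul]
  exact relIndex_pointwise_smul (MulAut.conj g) _ _

theorem centralizer_relIndex_smul_sylow [Finite G] (z g : G) (P : Sylow p G) {s : ℕ}
    (h : (centralizer {z}).relIndex P ≤ s) :
    (centralizer {g * z * g⁻¹}).relIndex ((g • P : Sylow p G) : Subgroup G) ≤ s := by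
  rw [← relIndex_smul_sylow _ g] at h
  refine (relIndex_anti_left ?_).trans h
  rintro _ ⟨x, hx, rfl⟩
  have h1 := mem_centralizer_singleton_iff.1 hx
  rw [mem_centralizer_singleton_iff]
  have h2 := congrArg (fun y => g * y * g⁻¹) h1
  simpa [mul_assoc] using h2

theorem centralizer_le_of_mem_closure {A : Set G} {f : G} (hf : f ∈ closure A) :
    centralizer A ≤ centralizer {f} := by
  rw [← centralizer_closure A]
  exact centralizer_le (Set.singleton_subset_iff.2 hf)

/-- A relative form of Baer's theorem. -/
theorem mem_pcore_of_eng [Finite G] [Fact p.Prime] {H : Subgroup G} {e : G} (he : e ∈ H)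
    (hp : IsPGroup p (zpowers e)) (h : ∀ g ∈ H, Eng g e) : e ∈ pcore p H := by
  obtain ⟨k, hk⟩ := hp ⟨e, mem_zpowers e⟩
  have hk' : e ^ p ^ k = 1 := by simpa using congrArg Subtype.val hk
  have h1 : IsPGroup p (zpowers (⟨e, he⟩ : H)) :=
    isPGroup_zpowers_of_pow_eq_one (k := k) (Subtype.ext (by simpa using hk'))
  have h2 := isPGroup_normalClosure_of_eng h1 fun g => by
    obtain ⟨n, hn⟩ := h g g.2
    exact ⟨n, Subtype.ext (by rw [engel_coe, hn, coe_one])⟩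
  refine le_pcore (map_subtype_le (normalClosure {(⟨e, he⟩ : H)})) ?_ (h2.map _)
    ⟨⟨e, he⟩, subset_normalClosure rfl, rfl⟩
  have h3 := le_normalizer_map (H := normalClosure {(⟨e, he⟩ : H)}) H.subtype
  rwa [normalizer_eq_top, ← MonoidHom.range_eq_map, range_subtype] at h3

theorem exists_ne_one_centralized [Finite G] [hp : Fact p.Prime] {P : Subgroup G}
    (hP : IsPGroup p P) (h1 : 1 < Nat.card P) : ∃ e ∈ P, e ≠ 1 ∧ P ≤ centralizer {e} := by
  have : Nontrivial P := Finite.one_lt_card_iff_nontrivial.1 h1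
  have := hP.center_nontrivial
  obtain ⟨⟨e, he⟩, he1⟩ := exists_ne (1 : center P)
  refine ⟨e, e.2, fun h => he1 (Subtype.ext (Subtype.ext h)), fun x hx => ?_⟩
  rw [mem_centralizer_singleton_iff]
  exact congrArg Subtype.val (mem_center_iff.1 he ⟨x, hx⟩)

/-- Coprime elements acting on the centralizer of a `p`-element nearly centralize its
`p`-subgroups. -/
theorem centralizer_relIndex_le_of_coprime [Finite G] [Fact p.Prime] (hS : BoundedSinks p m c w G)
    {u f : G} (hu : IsPGroup p (zpowers u)) (hu1 : u ≠ 1) (hf : p.Coprime (orderOf f))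
    (hfu : f ∈ centralizer {u}) {S : Subgroup G} (hSu : S ≤ centralizer {u})
    (hSp : IsPGroup p S) : (centralizer {f}).relIndex S ≤ m * c := by
  have h1 := hS.bdd u (exists_not_eng hS hu hu1) S hSu hSp
  refine relIndex_trans (S := pcore p (centralizer {u}) ⊓ S) ?_ (by rwa [inf_relIndex_right])
  exact relIndex_centralizer_le hS.sinks (isPGroup_pcore _) inf_le_left hf
    (le_normalizer_pcore _ hfu)

/-- The bound for the index of large intersections of Sylow subgroups. -/
abbrev fusionBound (m c w : ℕ) : ℕ := (c * w) * (c * (m * c * ((c * m) ^ (c * m) * (c * m))))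

theorem relIndex_sylow_le_of_card_inf [Finite G] [hp : Fact p.Prime] (hS : BoundedSinks p m c w G)
    (hw : 0 < w) (hcm : 0 < c * m) {P₁ P₂ : Sylow p G}
    (h : w * ((c * m) ^ (c * m) * (c * m)) < Nat.card (P₁ ⊓ P₂ : Subgroup G)) :
    (P₁ : Subgroup G).relIndex P₂ ≤ fusionBound m c w := by
  have hpos : c * m ≤ (c * m) ^ (c * m) * (c * m) :=
    Nat.le_mul_of_pos_left _ (Nat.pow_pos hcm)
  have hcard2 : c * m < Nat.card (P₂ : Subgroup G) :=
    (hpos.trans (Nat.le_mul_of_pos_left _ hw)).trans_lt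
      (h.trans_le (card_le_of_le inf_le_right))
  have hcard1 : 1 < Nat.card (P₁ : Subgroup G) := by
    rw [card_sylow_eq P₁ P₂]; omega
  obtain ⟨e, he, he1, hPe⟩ := exists_ne_one_centralized P₁.isPGroup' hcard1
  obtain ⟨f, hf, hfp, hfx⟩ := exists_coprime_not_eng hS (isPGroup_zpowers_of_mem_sylow he) he1
  have hCf := centralizer_le_of_mem_closure hf
  have hidx1 := hS.idx e P₁ hPe
  obtain ⟨J, hJP, hJc, hJ⟩ := exists_large_bounded_centralizer P₂.isPGroup' hcm hcard2
  obtain ⟨u, ⟨hu1, hu2⟩, ⟨huf, huJ⟩, hu⟩ := exists_ne_one_of_relIndex_lt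
    (relIndex_inf_le_mul ((relIndex_mono_right inf_le_left).trans hidx1)
      ((relIndex_mono_right inf_le_right).trans hJ)) h
  have h3 : (centralizer {f}).relIndex J ≤ m * c := by
    refine centralizer_relIndex_le_of_coprime hS (isPGroup_zpowers_of_mem_sylow hu1) hu hfp
      (mem_centralizer_singleton_comm.1 (hCf huf)) (fun x hx => ?_) (P₂.isPGroup'.to_le hJP)
    rw [mem_centralizer_singleton_iff]
    exact mem_centralizer_iff.1 huJ x hx
  obtain ⟨e', heJ, hef, he'⟩ := exists_ne_one_of_relIndex_lt h3 (by rwa [mul_comm])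
  have h4 : (centralizer {f}).relIndex (centralizer (J : Set G) ⊓ P₂ : Subgroup G) ≤ m * c := by
    refine centralizer_relIndex_le_of_coprime hS (isPGroup_zpowers_of_mem_sylow (hJP heJ)) he' hfp
      (mem_centralizer_singleton_comm.1 hef) (inf_le_left.trans ?_)
      (P₂.isPGroup'.to_le inf_le_right)
    exact centralizer_le (Set.singleton_subset_iff.2 heJ)
  have h5 : (centralizer {f}).relIndex P₂ ≤ m * c * ((c * m) ^ (c * m) * (c * m)) :=
    relIndex_trans h4 (by rwa [inf_relIndex_right])
  exact (hS.bdd f hfx).relIndex_sylow_le ((relIndex_anti_left hCf).trans hidx1) h5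

/-- Hypotheses under which nearness of Sylow subgroups is an equivalence relation. -/
structure LargeSylow (p m c w : ℕ) (G : Type*) [Group G] : Prop extends BoundedSinks p m c w G where
  w_pos : 0 < w
  cm_pos : 0 < c * m
  large : ∀ P : Sylow p G, (fusionBound m c w * fusionBound m c w +
    (c * (w * (w * (m * c)))) * (c * (w * (w * (m * c))))) *
      (w * ((c * m) ^ (c * m) * (c * m))) < Nat.card (P : Subgroup G)

/-- Two Sylow subgroups are near if they have a large intersection. -/
def Near (m c w : ℕ) (P Q : Sylow p G) : Prop :=
  (P : Subgroup G).relIndex Q ≤ fusionBound m c w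

theorem near_of_relIndex_le [Finite G] [Fact p.Prime] (hL : LargeSylow p m c w G)
    {P Q : Sylow p G} {X : ℕ} (hX : X ≤ fusionBound m c w * fusionBound m c w +
      (c * (w * (w * (m * c)))) * (c * (w * (w * (m * c)))))
    (h : (P : Subgroup G).relIndex Q ≤ X) : Near m c w P Q := by
  refine relIndex_sylow_le_of_card_inf hL.toBoundedSinks hL.w_pos hL.cm_pos ?_
  have h1 := hL.large Q
  rw [card_eq_relIndex_mul (P : Subgroup G) (Q : Subgroup G)] at h1
  exact Nat.lt_of_mul_lt_mul_left (h1.trans_le (Nat.mul_le_mul_right _ (h.trans hX)))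

theorem near_equivalence [Finite G] [Fact p.Prime] (hL : LargeSylow p m c w G) :
    Equivalence (Near m c w : Sylow p G → Sylow p G → Prop) where
  refl P := by
    have hc := Nat.pos_of_mul_pos_right hL.cm_pos
    have hm := Nat.pos_of_mul_pos_left hL.cm_pos
    have hw := hL.w_pos
    rw [Near, relIndex_self]
    exact Nat.succ_le_of_lt (by have := Nat.pow_pos (n := c * m) hL.cm_pos; positivity)
  symm {P Q} h := by
    rw [Near, relIndex_sylow_comm]; exact h
  trans {P Q R} h1 h2 := near_of_relIndex_le hL (Nat.le_add_right _ _) (relIndex_trans h1 h2)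

theorem near_smul (g : G) {P Q : Sylow p G} (h : Near m c w P Q) :
    Near m c w (g • P) (g • Q) := by
  rwa [Near, relIndex_smul_smul_sylow]

theorem near_of_centralizer [Finite G] [Fact p.Prime] (hL : LargeSylow p m c w G)
    {P Q : Sylow p G} {z : G} (hz : ∃ x, ¬ Eng z x)
    (hP : (centralizer {z}).relIndex P ≤ w * (w * (m * c)))
    (hQ : (centralizer {z}).relIndex Q ≤ w * (w * (m * c))) : Near m c w P Q :=
  near_of_relIndex_le hL (Nat.le_add_left _ _) ((hL.bdd z hz).relIndex_sylow_le hP hQ)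

theorem centralizer_rsink_relIndex_sylow_le [Finite G] (hS : BoundedSinks p m c w G)
    {P : Sylow p G} {f : G} {s : ℕ} (h : (centralizer {f}).relIndex P ≤ s) :
    (centralizer (rsink f)).relIndex P ≤ w * s :=
  relIndex_trans (hS.idx f (centralizer {f} ⊓ P) inf_le_left) (by rwa [inf_relIndex_right])

/-- If Sylow subgroups nearly centralized by `f` and `f'` are not near, then `f` is Engel against
`f'`. -/
theorem eng_of_not_near [Finite G] [Fact p.Prime] (hL : LargeSylow p m c w G)
    {P₁ P₂ : Sylow p G} {f f' : G} (h1 : (centralizer {f}).relIndex P₁ ≤ w * (m * c))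
    (h2 : (centralizer {f'}).relIndex P₂ ≤ w * (m * c)) (h12 : ¬ Near m c w P₁ P₂) : Eng f f' := by
  by_contra hE
  refine h12 ?_
  have hwle : w * (m * c) ≤ w * (w * (m * c)) := Nat.mul_le_mul_left _
    (Nat.le_mul_of_pos_left _ hL.w_pos)
  have heq := near_equivalence hL
  obtain ⟨z, hz1, ⟨k, hk, hkz⟩, hzi, N, hN⟩ := exists_periodic_of_not_eng hE
  have hzE : ∃ x, ¬ Eng z x := ⟨f', not_eng_of_periodic hk hkz hz1⟩
  have hD := centralizer_rsink_relIndex_sylow_le hL.toBoundedSinks h1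
  have hz : (centralizer {z}).relIndex P₁ ≤ w * (w * (m * c)) :=
    (relIndex_anti_left (centralizer_le (Set.singleton_subset_iff.2 (hzi 0)))).trans hD
  have hn1 : Near m c w P₁ (f' • P₁) := by
    refine near_of_centralizer hL hzE hz ?_
    have h3 : (centralizer {f'⁻¹ * z * f'}).relIndex P₁ ≤ w * (w * (m * c)) := by
      refine (relIndex_anti_left (centralizer_le_of_mem_closure ?_)).trans hD
      have h4 := mul_mem (subset_closure (hzi 0)) (subset_closure (hzi 1))
      rw [engel_succ, engel_zero, cmtr] at h4
      simpa [mul_assoc] using h4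
    have h4 := centralizer_relIndex_smul_sylow _ f' P₁ h3
    simpa [mul_assoc] using h4
  have hn2 : Near m c w P₁ (f • P₁) := by
    refine near_of_centralizer hL ⟨f', hE⟩ (h1.trans hwle) ?_
    have h4 := centralizer_relIndex_smul_sylow _ f P₁ (h1.trans hwle)
    simpa using h4
  have hn3 : Near m c w P₁ ((f * f') • P₁) := by
    rw [mul_smul]
    exact heq.trans hn2 (near_smul f hn1)
  refine heq.trans hn3 (near_of_centralizer hL (z := f * f' * z * (f * f')⁻¹) ?_
    (centralizer_relIndex_smul_sylow _ _ _ hz) ?_)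
  · obtain ⟨x, hx⟩ := hzE
    refine ⟨f * f' * x * (f * f')⁻¹, fun h => hx ?_⟩
    have := h.conj (f * f')⁻¹
    simpa [mul_assoc] using this
  · have h3 : (centralizer {f'⁻¹}).relIndex P₂ ≤ w * (m * c) := by
      refine (relIndex_anti_left fun x hx => ?_).trans h2
      rw [mem_centralizer_singleton_iff] at hx ⊢
      exact (Commute.inv_right (a := x) (b := f') hx).eq
    refine (relIndex_anti_left (centralizer_le (Set.singleton_subset_iff.2 ?_))).trans
      (centralizer_rsink_relIndex_sylow_le hL.toBoundedSinks h3)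
    have hx : f * f' * f' * (f * f')⁻¹ = f * f' * f⁻¹ := by group
    refine ⟨f * f' * f' * (f * f')⁻¹, ⟨N + (k * 2 - 2) + 1, ?_⟩, k, hk, by rw [engel_conj, hkz]⟩
    have h1 := engel_mul_period hkz 2
    rw [← hN, ← engel_add, show N + k * 2 = N + (k * 2 - 2) + 2 by omega, engel_heineken, hN] at h1
    rw [hx]
    generalize engel f'⁻¹ (f * f' * f⁻¹) (N + (k * 2 - 2) + 1) = y at h1 ⊢
    rw [← h1]
    group

theorem near_all [Finite G] [Fact p.Prime] (hL : LargeSylow p m c w G) (P Q : Sylow p G) :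
    Near m c w P Q := by
  by_contra hcon
  have heq := near_equivalence hL
  have hS := hL.toBoundedSinks
  have hmc : 0 < m * c := by rw [mul_comm]; exact hL.cm_pos
  have hle1 : 1 ≤ w * (m * c) := Nat.mul_pos hL.w_pos hmc
  have hlew : w ≤ w * (m * c) := Nat.le_mul_of_pos_right _ hmc
  have hlemc : m * c ≤ w * (m * c) := Nat.le_mul_of_pos_left _ hL.w_pos
  have hlew2 : w * (m * c) ≤ w * (w * (m * c)) := Nat.le_mul_of_pos_left _ hL.w_pos
  obtain ⟨P₁, P₂, h12, hmax⟩ := exists_maximal_inter (R := Near (G := G) (p := p) m c w) Set.univ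
    fun h => hcon (h P Q)
  have hcard : ∀ P : Sylow p G, 1 < Nat.card (P : Subgroup G) := by
    intro P
    by_contra! hc
    have h1 : (P₁ : Subgroup G) = P₂ := by
      rw [card_sylow_eq P P₁] at hc
      have h2 := hc
      rw [card_sylow_eq P₁ P₂] at h2
      rw [eq_bot_of_card_le _ hc, eq_bot_of_card_le _ h2]
    exact h12 (Sylow.ext h1 ▸ heq.refl P₁)
  obtain ⟨e, he, he1, hPe⟩ := exists_ne_one_centralized P₁.isPGroup' (hcard P₁)
  have hep := isPGroup_zpowers_of_mem_sylow he
  have hidx1 : (centralizer {e}).relIndex P₁ ≤ w * (m * c) := by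
    rw [relIndex_eq_one.2 hPe]; exact hle1
  have heP2 : e ∈ (P₂ : Subgroup G) := by
    have hTu : ∀ g : G, ∀ t ∈ (Set.univ : Set G), g * t * g⁻¹ ∈ (Set.univ : Set G) :=
      fun _ _ _ => Set.mem_univ _
    have hex : ∃ t ∈ (Set.univ : Set G), t ∈ (P₂ : Subgroup G) ∧ t ∉ (P₁ ⊓ P₂ : Subgroup G) := by
      by_contra! hc
      refine h12 ?_
      have h1 : (P₁ : Subgroup G).relIndex P₂ = 1 :=
        relIndex_eq_one.2 fun x hx => (hc x (Set.mem_univ x) hx).1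
      have h2 := heq.refl P₁
      rw [Near, relIndex_self] at h2
      rw [Near, h1]
      exact h2
    obtain ⟨v, hvT, hv2, hv1, hvn⟩ :=
      exists_mem_normalizer_notMem hTu P₂.isPGroup' inf_le_right hex
    rw [coe_inf, ← Set.inter_assoc] at hvn
    refine mem_of_maximal_intersection hTu heq (fun g _ _ => near_smul g) h12 hmax
      (Set.mem_univ e) he ?_ hvT hv2 (fun h => hv1 ⟨h, hv2⟩) hvn fun g hg => ?_
    · rw [mem_set_normalizer_iff]
      intro x
      have hx : ∀ x ∈ (P₁ : Subgroup G), e * x * e⁻¹ = x := fun x hx => by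
        rw [← mem_centralizer_singleton_iff.1 (hPe hx), mul_inv_cancel_right]
      constructor
      · intro h
        rwa [hx x h.1.2]
      · intro h
        have h1 : x ∈ (P₁ : Subgroup G) := by
          have := mul_mem (mul_mem (inv_mem he) h.1.2) he
          simpa [mul_assoc] using this
        rwa [hx x h1] at h
    · have hinv : (centralizer {e⁻¹}).relIndex P₁ ≤ w * (m * c) := by
        refine (relIndex_anti_left fun x hx => ?_).trans hidx1
        rw [mem_centralizer_singleton_iff] at hx ⊢
        exact (Commute.inv_right (a := x) (b := e) hx).eq
      rw [eng_heineken]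
      exact eng_of_not_near hL hinv (centralizer_relIndex_smul_sylow _ g _ hidx1)
        fun h => hg (heq.symm h)
  obtain ⟨d, hd, hd1, hPd⟩ := exists_ne_one_centralized P₂.isPGroup' (hcard P₂)
  obtain ⟨f, hf, hfp, hfx⟩ := exists_coprime_not_eng hS (isPGroup_zpowers_of_mem_sylow hd) hd1
  have hcl : ∀ y ∈ closure (rsink d), (centralizer {y}).relIndex P₂ ≤ w := fun y hy =>
    (relIndex_anti_left (centralizer_le_of_mem_closure hy)).trans (hS.idx d P₂ hPd)
  have hEng : ∀ y ∈ closure (rsink d), Eng y e := fun y hy =>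
    eng_of_not_near hL ((hcl y hy).trans hlew) hidx1 fun h => h12 (heq.symm h)
  -- `e` lies in the `p`-core of `⟨rsink d, e⟩`
  have hen : e ∈ normalizer (closure (rsink d) : Set G) := by
    refine mem_normalizer_fintype fun y hy => ?_
    have : closure (rsink d) ≤ (closure (rsink d)).comap (MulAut.conj e).toMonoidHom := by
      rw [closure_le]
      intro y hy
      refine subset_closure (conj_mem_rsink_of_commute hy ?_)
      exact mem_centralizer_singleton_iff.1 (hPd heP2)
    exact this hy
  have hcomm : Commute e f := by
    have h1 : e ∈ pcore p (zpowers e ⊔ closure (rsink d)) := by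
      refine mem_pcore_of_eng (mem_sup_left (mem_zpowers e)) hep fun g hg => ?_
      rw [← SetLike.mem_coe, coe_mul_of_left_le_normalizer_right _ _ (zpowers_le.2 hen)] at hg
      obtain ⟨x, hx, y, hy, rfl⟩ := hg
      obtain ⟨i, rfl⟩ := mem_zpowers_iff.1 hx
      obtain ⟨n, hn⟩ := hEng y hy
      refine ⟨n + 1, ?_⟩
      rw [engel_mul_left_of_commute ((Commute.refl e).zpow_left i)]
      exact engel_eq_one_of_le hn (Nat.le_succ n)
    refine commute_of_eng (isPGroup_pcore _) hfp (le_normalizer_pcore _ (mem_sup_right hf)) h1 ?_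
    exact eng_of_not_near hL hidx1 ((hcl f hf).trans hlew) h12
  have hf1 : (centralizer {f}).relIndex P₁ ≤ m * c :=
    centralizer_relIndex_le_of_coprime hS hep he1 hfp
      (mem_centralizer_singleton_iff.2 hcomm.eq.symm) hPe P₁.isPGroup'
  exact h12 (near_of_centralizer hL hfx ((hf1.trans hlemc).trans hlew2)
    (((hcl f hf).trans hlew).trans hlew2))

end SylowFusion

section ConjugateGeneration

open Subgroup

variable {G : Type*} [Group G] {p m c w : ℕ}

/-- The subgroup generated by the conjugates of `J` by the elements of `A`. -/
def conjSup (J : Subgroup G) (A : Finset G) : Subgroup G :=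
  ⨆ a ∈ A, J.map (MulAut.conj a).toMonoidHom

theorem conjSup_mono (J : Subgroup G) {A B : Finset G} (h : A ⊆ B) : conjSup J A ≤ conjSup J B :=
  biSup_mono fun _ ha => h ha

theorem le_conjSup {J : Subgroup G} {A : Finset G} (h : 1 ∈ A) : J ≤ conjSup J A := by
  refine le_trans ?_ (le_iSup₂_of_le (f := fun a (_ : a ∈ A) => J.map (MulAut.conj a).toMonoidHom)
    1 h le_rfl)
  intro x hx
  exact ⟨x, hx, by simp⟩

theorem conjSup_image [DecidableEq G] (J : Subgroup G) (A : Finset G) (h : G) :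
    conjSup J (A.image (h * ·)) = (conjSup J A).map (MulAut.conj h).toMonoidHom := by
  simp only [conjSup, Finset.iSup_finset_image, Subgroup.map_iSup, Subgroup.map_map]
  refine iSup_congr fun a => iSup_congr fun _ => ?_
  congr 1
  ext x
  simp [mul_assoc]

theorem map_pcore_le [Finite G] {G' : Type*} [Group G'] (f : G →* G') (H : Subgroup G) :
    (pcore p H).map f ≤ pcore p (H.map f) :=
  le_pcore (map_mono (pcore_le H)) ((map_mono (le_normalizer_pcore H)).trans
    (le_normalizer_map _)) ((isPGroup_pcore H).map _)

theorem pcore_inf_eq_of_relIndex_le [Finite G] {J H K : Subgroup G} (hJ : J ≤ H) (hHK : H ≤ K)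
    (h : (pcore p K).relIndex J ≤ (pcore p H).relIndex J) {v : G} (hv : v ∈ J)
    (hvH : v ∈ pcore p H) : v ∈ pcore p K := by
  have h1 : pcore p K ⊓ J ≤ pcore p H ⊓ J :=
    le_inf ((inf_le_inf_left _ hJ).trans (pcore_inf_le hHK)) inf_le_right
  have h2 := card_eq_relIndex_mul (pcore p K) J
  rw [card_eq_relIndex_mul (pcore p H) J] at h2
  have h3 : Nat.card (pcore p H ⊓ J : Subgroup G) ≤ Nat.card (pcore p K ⊓ J : Subgroup G) := by
    refine Nat.le_of_mul_le_mul_left (h2.le.trans (Nat.mul_le_mul_right _ h)) ?_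
    exact Nat.pos_of_ne_zero index_ne_zero_of_finite
  have h4 : v ∈ (pcore p H ⊓ J : Subgroup G) := ⟨hvH, hv⟩
  rw [← eq_of_le_of_card_ge h1 h3] at h4
  exact h4.1

theorem centralizer_map_conj_relIndex_le [Finite G] [Fact p.Prime] (hL : LargeSylow p m c w G)
    (P : Sylow p G) {J : Subgroup G} {s : ℕ} (hJ : (centralizer (J : Set G)).relIndex P ≤ s)
    (a : G) : (centralizer (J.map (MulAut.conj a).toMonoidHom : Set G)).relIndex P ≤
      s * fusionBound m c w := by
  refine relIndex_trans ?_ (near_all hL (a • P) P)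
  rw [← relIndex_smul_sylow _ a] at hJ
  refine (relIndex_anti_left ?_).trans hJ
  rintro _ ⟨x, hx, rfl⟩
  rw [mem_centralizer_iff]
  rintro _ ⟨y, hy, rfl⟩
  have := congrArg (MulAut.conj a) (mem_centralizer_iff.1 hx y hy)
  simpa using this

theorem exists_conjSup_le_centralizer [Finite G] {P J : Subgroup G} {X : ℕ}
    (hX : 0 < X) (h : ∀ a, (centralizer (J.map (MulAut.conj a).toMonoidHom : Set G)).relIndex P ≤ X)
    {n : ℕ} (hn : X ^ n < Nat.card P) {A : Finset G} (hA : A.card ≤ n) :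
    ∃ u ∈ P, u ≠ 1 ∧ conjSup J A ≤ centralizer {u} := by
  have h1 : (⨅ a : A, centralizer (J.map (MulAut.conj (a : G)).toMonoidHom : Set G)).relIndex P ≤
      X ^ n := by
    refine (relIndex_iInf_le _).trans ((Finset.prod_le_pow_card _ _ X fun a _ => h a.1).trans ?_)
    exact Nat.pow_le_pow_right hX (by simpa using hA)
  obtain ⟨u, huP, hu, hu1⟩ := exists_ne_one_of_relIndex_lt h1 hn
  refine ⟨u, huP, hu1, iSup₂_le fun a ha x hx => ?_⟩
  rw [mem_centralizer_singleton_iff]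
  exact mem_centralizer_iff.1 (mem_iInf.1 hu ⟨a, ha⟩) x hx

/-- The bound for the order of the Sylow subgroups in a group with bounded sinks. -/
def sylowBound (m c w : ℕ) : ℕ :=
  (fusionBound m c w * fusionBound m c w +
    (c * (w * (w * (m * c)))) * (c * (w * (w * (m * c))))) *
      (w * ((c * m) ^ (c * m) * (c * m))) + c * m +
  ((c * m) ^ (c * m) * (c * m) * fusionBound m c w) ^ 2 ^ (c + 1)

theorem card_sylow_le [Finite G] [Fact p.Prime] (hS : BoundedSinks p m c w G) (hw : 0 < w)
    (hcm : 0 < c * m) (P : Sylow p G) : Nat.card (P : Subgroup G) ≤ sylowBound m c w := by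
  classical
  by_contra! hcon
  rw [sylowBound] at hcon
  have hL : LargeSylow p m c w G := ⟨hS, hw, hcm, fun Q => by
    rw [card_sylow_eq Q P]
    exact lt_of_le_of_lt ((Nat.le_add_right _ _).trans (Nat.le_add_right _ _)) hcon⟩
  obtain ⟨J, hJP, hJc, hJ⟩ := exists_large_bounded_centralizer P.isPGroup' hcm
    (lt_of_le_of_lt ((Nat.le_add_left _ _).trans (Nat.le_add_right _ _)) hcon)
  have hX := centralizer_map_conj_relIndex_le hL P hJ
  have hXpos : 0 < (c * m) ^ (c * m) * (c * m) * fusionBound m c w := by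
    have hc := Nat.pos_of_mul_pos_right hcm
    have hm := Nat.pos_of_mul_pos_left hcm
    have := Nat.pow_pos (n := c * m) hcm
    positivity
  have hbdd : ∀ A : Finset G, A.card ≤ 2 ^ (c + 1) → PBdd p c (conjSup J A) := by
    intro A hA
    obtain ⟨u, huP, hu1, hu⟩ := exists_conjSup_le_centralizer hXpos hX
      (lt_of_le_of_lt (Nat.le_add_left _ _) hcon) hA
    exact (hS.bdd u (exists_not_eng hS (isPGroup_zpowers_of_mem_sylow huP) hu1)).mono hu
  let ι : Finset G → ℕ := fun A => (pcore p (conjSup J A)).relIndex J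
  have hι : ∀ A : Finset G, 1 ∈ A → A.card ≤ 2 ^ (c + 1) → ι A ≤ c := fun A h1 hA =>
    hbdd A hA J (le_conjSup h1) (P.isPGroup'.to_le hJP)
  let T : Set (Finset G) := {A | 1 ∈ A ∧ A.card ≤ 2 ^ (c + 1) ∧ A.card ≤ 2 ^ ι A}
  obtain ⟨A, ⟨hA1, hAc, hAι⟩, hmax⟩ := Set.exists_max_image T ι (Set.toFinite T)
    ⟨{1}, by simp, by simpa using Nat.one_le_two_pow, by simpa using Nat.one_le_two_pow⟩
  obtain ⟨v, hvJ, hvA, hv1⟩ := exists_ne_one_of_relIndex_lt (hι A hA1 hAc)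
    (lt_of_le_of_lt (Nat.le_mul_of_pos_right _ (Nat.pos_of_mul_pos_left hcm)) hJc)
  have hext : ∀ B : Finset G, B.card ≤ A.card → v ∈ pcore p (conjSup J (A ∪ B)) := by
    intro B hB
    have hc1 : (A ∪ B).card ≤ 2 ^ (ι A + 1) := by
      have := Finset.card_union_le A B
      rw [pow_succ]
      omega
    have hc2 : (A ∪ B).card ≤ 2 ^ (c + 1) :=
      hc1.trans (Nat.pow_le_pow_right two_pos (Nat.succ_le_succ (hι A hA1 hAc)))
    refine pcore_inf_eq_of_relIndex_le (le_conjSup hA1)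
      (conjSup_mono J Finset.subset_union_left) ?_ hvJ hvA
    by_contra! hlt
    exact absurd (hmax (A ∪ B) ⟨Finset.mem_union_left _ hA1, hc2,
      hc1.trans (Nat.pow_le_pow_right two_pos hlt)⟩) (not_le.2 hlt)
  refine hv1 (eq_one_of_isPGroup_normalClosure hS (isPGroup_normalClosure_of_pairs fun h => ?_))
  refine ⟨pcore p (conjSup J (A ∪ A.image (h * ·))), isPGroup_pcore _,
    hext _ Finset.card_image_le, ?_⟩
  have h1 := map_pcore_le (MulAut.conj h).toMonoidHom _
    (mem_map_of_mem _ (hext (A.image (h⁻¹ * ·)) Finset.card_image_le))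
  rwa [← conjSup_image, Finset.image_union, Finset.image_image,
    show ((h * ·) ∘ (h⁻¹ * ·) : G → G) = id by ext; simp, Finset.image_id, Finset.union_comm] at h1

end ConjugateGeneration

section Reduction

open Subgroup

variable {G : Type*} [Group G]

theorem mem_normalizer_closure_engel [Finite G] (z y : G) :
    y ∈ normalizer (closure (Set.range (engel z y)) : Set G) := by
  suffices h : y⁻¹ ∈ normalizer (closure (Set.range (engel z y)) : Set G) by
    simpa using inv_mem h
  refine mem_normalizer_fintype fun x hx => ?_
  have : closure (Set.range (engel z y)) ≤
      (closure (Set.range (engel z y))).comap (MulAut.conj y⁻¹).toMonoidHom := by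
    rw [closure_le]
    rintro _ ⟨i, rfl⟩
    have h2 := mul_mem (subset_closure ⟨i, rfl⟩ : engel z y i ∈ closure (Set.range (engel z y)))
      (subset_closure ⟨i + 1, rfl⟩)
    rw [engel_succ, cmtr] at h2
    simpa [mul_assoc] using h2
  exact this hx

theorem mem_normalizer_centralizer {A : Subgroup G} {y : G} (hy : y ∈ normalizer (A : Set G)) :
    y ∈ normalizer (centralizer (A : Set G) : Set G) := by
  have key : ∀ k ∈ normalizer (A : Set G), ∀ x ∈ centralizer (A : Set G),
      k * x * k⁻¹ ∈ centralizer (A : Set G) := by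
    intro k hk x hx
    rw [mem_centralizer_iff]
    intro a ha
    have h1 := (mem_normalizer_iff.1 (inv_mem hk) a).1 ha
    have h2 := congrArg (fun b => k * b * k⁻¹) (mem_centralizer_iff.1 hx _ h1)
    simpa [mul_assoc] using h2
  rw [mem_normalizer_iff]
  refine fun x => ⟨key y hy x, fun hx => ?_⟩
  simpa [mul_assoc] using key y⁻¹ (inv_mem hy) _ hx

theorem engel_mul_of_mem_centralizer [Finite G] {z y β : G}
    (hβ : β ∈ centralizer (closure (Set.range (engel z y)) : Set G)) (n : ℕ) :
    engel (z * β) y n = engel z y n * engel β y n := by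
  induction n with
  | zero => rfl
  | succ n ih =>
    have h1 := engel_mem_of_mem_normalizer
      (mem_normalizer_centralizer (mem_normalizer_closure_engel z y)) hβ n
    have h2 := mem_centralizer_iff.1 h1 _ (subset_closure ⟨n + 1, rfl⟩)
    rw [engel_succ, ih, engel_succ, engel_succ]
    rw [engel_succ] at h2
    generalize engel β y n = x at h2 ⊢
    generalize engel z y n = t at h2 ⊢
    have h3 : cmtr (t * x) y = x⁻¹ * (cmtr t y * x) * (x⁻¹ * y⁻¹ * x * y) := by
      simp only [cmtr]; group
    rw [h3, h2]
    simp only [cmtr]; group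

instance normal_subgroupOf_centralizer (A : Subgroup G) :
    (A.subgroupOf (centralizer (A : Set G))).Normal := by
  refine ⟨fun x hx b => ?_⟩
  rw [mem_subgroupOf] at hx ⊢
  have := mem_centralizer_iff.1 b.2 _ hx
  rw [coe_mul, coe_mul, ← this, coe_inv, mul_inv_cancel_right]
  exact hx

/-- Sinks shrink in a section of the centralizer of a periodic Engel sequence. -/
theorem SinksLE.quotient_centralizer [Finite G] {m : ℕ} (h : SinksLE G (m + 1)) {z y : G} {k : ℕ}
    (hk : 0 < k) (hz : engel z y k = z) (hz1 : z ≠ 1) :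
    SinksLE (centralizer (closure (Set.range (engel z y)) : Set G) ⧸
      (closure (Set.range (engel z y))).subgroupOf
        (centralizer (closure (Set.range (engel z y)) : Set G))) m := by
  set Z := closure (Set.range (engel z y)) with hZ
  set B := centralizer (Z : Set G) with hB
  have hzZ : z ∈ Z := subset_closure ⟨0, rfl⟩
  intro β'
  obtain ⟨β, rfl⟩ := QuotientGroup.mk'_surjective (Z.subgroupOf B) β'
  refine (Set.ncard_le_ncard (rsink_map_subset _ (QuotientGroup.mk'_surjective _) β)
    (Set.toFinite _)).trans ?_
  by_contra! hcon
  have hcoe : (Subtype.val '' rsink β : Set G).ncard = (rsink β).ncard :=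
    Set.ncard_image_of_injective _ Subtype.val_injective
  have hle : (QuotientGroup.mk' (Z.subgroupOf B) '' rsink β).ncard ≤ (rsink β).ncard :=
    Set.ncard_image_le (Set.toFinite _)
  have key : ∀ g : G, (Subtype.val '' rsink β : Set G) ⊆ rsink g →
      (Subtype.val '' rsink β : Set G) = rsink g := fun g hg =>
    Set.eq_of_subset_of_ncard_le hg (by have := h g; omega) (Set.toFinite _)
  have h1 := key β (by rintro _ ⟨a, ha, rfl⟩; exact coe_mem_rsink ha)
  have h2 := key (z * β) (by
    rintro _ ⟨a, ⟨x, ⟨n, hn⟩, l, hl, hla⟩, rfl⟩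
    have hla' : engel (a : G) x l = a := by rw [← engel_coe, hla]
    refine ⟨x, ⟨n + (l - 1) + 1, ?_⟩, l, hl, hla'⟩
    rw [engel_mul_left_of_commute (mem_centralizer_iff.1 x.2 z hzZ),
      show n + (l - 1) + 1 = n + l by omega, engel_add, ← engel_coe, hn, hla'])
  have hinj : Set.InjOn (QuotientGroup.mk' (Z.subgroupOf B)) (rsink β) := by
    refine Set.injOn_of_ncard_image_eq (hle.antisymm ?_) (Set.toFinite _)
    have := h β
    rw [← h1, hcoe] at this
    omega
  obtain ⟨N₁, hN₁⟩ := eventually_mem_rsink (β : G) y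
  obtain ⟨N₂, hN₂⟩ := eventually_mem_rsink (z * β) y
  have h3 := hN₁ (k * (N₁ + N₂)) (by nlinarith)
  have h4 := hN₂ (k * (N₁ + N₂)) (by nlinarith)
  rw [engel_mul_of_mem_centralizer β.2, engel_mul_period hz] at h4
  rw [← h1] at h3
  rw [← h2] at h4
  obtain ⟨a, ha, haeq⟩ := h3
  obtain ⟨b, hb, hbeq⟩ := h4
  rw [← haeq] at hbeq
  refine hz1 ?_
  have h5 : a = b := by
    refine hinj ha hb (QuotientGroup.eq.2 ?_)
    rw [mem_subgroupOf, coe_mul, hbeq, coe_inv, mem_centralizer_iff.1 a.2 z hzZ,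
      inv_mul_cancel_left]
    exact hzZ
  rw [h5] at hbeq
  exact mul_eq_right.1 hbeq.symm

variable {p b : ℕ}

theorem PBdd.of_top [Finite G] {H : Subgroup G} (h : PBdd p b (⊤ : Subgroup H)) : PBdd p b H := by
  intro S hS hSp
  have h1 : pcore p (⊤ : Subgroup H) ≤ (pcore p H).subgroupOf H := by
    have := map_pcore_le (p := p) H.subtype ⊤
    rwa [← MonoidHom.range_eq_map, range_subtype, map_le_iff_le_comap] at this
  have h2 := h (S.subgroupOf H) le_top (hSp.comap_subtype)
  rw [← relIndex_subgroupOf hS]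
  exact (relIndex_anti_left h1).trans h2

theorem PBdd.of_quotient_central [Finite G] [Fact p.Prime] {A : Subgroup G} [A.Normal]
    (hA : A ≤ center G) (h : PBdd p b (⊤ : Subgroup (G ⧸ A))) : PBdd p b (⊤ : Subgroup G) := by
  intro S _ hSp
  have h1 := h (S.map (QuotientGroup.mk' A)) le_top (hSp.map _)
  rw [← relIndex_comap, ← inf_relIndex_right] at h1
  refine (relIndex_anti_left ?_).trans h1
  rintro x ⟨hxT, hxS⟩
  refine mem_pcore_of_eng (mem_top x) (isPGroup_zpowers_of_mem hSp hxS) fun g _ => ?_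
  have hx : QuotientGroup.mk' A x ∈ pcore p (⊤ : Subgroup (G ⧸ A)) := hxT
  have hn : ∀ g : G ⧸ A, g ∈ normalizer (pcore p (⊤ : Subgroup (G ⧸ A)) : Set (G ⧸ A)) :=
    fun g => le_normalizer_pcore _ (mem_top g)
  have hc : cmtr (QuotientGroup.mk' A g) (QuotientGroup.mk' A x) ∈
      pcore p (⊤ : Subgroup (G ⧸ A)) := by
    have := mul_mem ((mem_normalizer_iff.1 (hn (QuotientGroup.mk' A g)⁻¹) _).1 (inv_mem hx)) hx
    simpa only [cmtr, inv_inv] using this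
  obtain ⟨n, hn⟩ := eng_of_isPGroup (isPGroup_pcore _) hc hx
  rw [← map_cmtr, ← map_engel] at hn
  have h2 := mem_center_iff.1 (hA ((QuotientGroup.eq_one_iff _).1 hn)) x
  refine ⟨1 + n + 1, ?_⟩
  rw [engel_succ, engel_add]
  exact cmtr_eq_one_iff.2 h2.symm

theorem pcore_top_normal (p : ℕ) (G : Type*) [Group G] : (pcore p (⊤ : Subgroup G)).Normal :=
  normalizer_eq_top_iff.1 (top_le_iff.1 (le_normalizer_pcore _))

theorem eq_bot_of_normal_quotient_pcore [Finite G] [(pcore p (⊤ : Subgroup G)).Normal]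
    {N : Subgroup (G ⧸ pcore p (⊤ : Subgroup G))} (hN : N.Normal) (hNp : IsPGroup p N) :
    N = ⊥ := by
  have h1 : N.comap (QuotientGroup.mk' _) ≤ pcore p (⊤ : Subgroup G) := by
    refine le_pcore le_top ?_ (hNp.comap_of_ker_isPGroup _ ?_)
    · rw [normalizer_eq_top]
    · rw [QuotientGroup.ker_mk']
      exact isPGroup_pcore _
  rw [eq_bot_iff]
  intro x hx
  obtain ⟨g, rfl⟩ := QuotientGroup.mk'_surjective _ x
  exact (QuotientGroup.eq_one_iff g).2 (h1 hx)

theorem PBdd.of_normal_relIndex [Finite G] {C H : Subgroup G} {c w : ℕ} (hC : PBdd p c C)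
    (hCH : C ≤ H) (hn : H ≤ normalizer (C : Set G)) (hw : ∀ S ≤ H, C.relIndex S ≤ w) :
    PBdd p (c * w) H := fun S hS hSp => by
  refine (relIndex_anti_left (le_pcore ((pcore_le C).trans hCH)
    (hn.trans fun _ => mem_normalizer_pcore) (isPGroup_pcore C))).trans ?_
  refine relIndex_trans (hC (C ⊓ S) inf_le_left (hSp.to_le inf_le_right)) ?_
  rw [inf_relIndex_right]
  exact hw S hS

theorem pBdd_centralizer [Finite G] [Fact p.Prime] {m : ℕ} (h : SinksLE G (m + 1))
    (hb : ∀ (z y : G) (k : ℕ), 0 < k → engel z y k = z → z ≠ 1 →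
      PBdd p b (centralizer (closure (Set.range (engel z y)) : Set G))) {g : G}
    (hg : ∃ x, ¬ Eng g x) : PBdd p (b * (m + 1) ^ (m + 1)) (centralizer {g}) := by
  obtain ⟨x, hx⟩ := hg
  obtain ⟨z, hz1, ⟨k, hk, hkz⟩, hzi, -⟩ := exists_periodic_of_not_eng hx
  have h1 : centralizer {g} ⊓ centralizer (rsink g) ≤
      centralizer (closure (Set.range (engel z x)) : Set G) := by
    rw [centralizer_closure]
    refine inf_le_right.trans (centralizer_le ?_)
    rintro _ ⟨i, rfl⟩
    exact hzi i
  refine ((hb z x k hk hkz hz1).mono h1).of_normal_relIndex inf_le_left (fun a ha => ?_)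
    fun S hS => ?_
  · refine mem_normalizer_fintype fun y hy => SetLike.mem_coe.2 (mem_inf.2 ⟨?_, ?_⟩)
    · exact mul_mem (mul_mem ha hy.1) (inv_mem ha)
    · rw [mem_centralizer_iff]
      intro r hr
      have ha' : Commute a⁻¹ g := Commute.inv_left (a := a) (mem_centralizer_singleton_iff.1 ha)
      have h2 := mem_centralizer_iff.1 hy.2 _ (conj_mem_rsink_of_commute hr ha')
      have h3 := congrArg (fun t => a * t * a⁻¹) h2
      simpa [mul_assoc] using h3
  · rw [← inf_relIndex_right, inf_right_comm, inf_eq_right.2 hS, inf_relIndex_left]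
    exact centralizer_rsink_relIndex_le h (Nat.succ_pos m) hS

/-- The `p`-subgroups of a finite group with bounded right Engel sinks are bounded modulo the
`p`-core. -/
theorem exists_pBdd (m : ℕ) : ∃ b : ℕ, ∀ (G : Type u) [Group G] [Finite G], SinksLE G m →
    ∀ (p : ℕ) [Fact p.Prime], PBdd p b (⊤ : Subgroup G) := by
  induction m with
  | zero =>
    refine ⟨0, fun G _ _ h => absurd (h 1) ?_⟩
    rw [Nat.le_zero, Set.ncard_eq_zero (Set.toFinite _)]
    exact Set.Nonempty.ne_empty ⟨1, 1, ⟨0, rfl⟩, 1, one_pos, engel_one_left _ _⟩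
  | succ m ih =>
    obtain ⟨b, hb⟩ := ih
    refine ⟨sylowBound (m + 1) ((b + 1) * (m + 1) ^ (m + 1)) ((m + 1) ^ (m + 1)),
      fun G _ _ h p _ => ?_⟩
    have := pcore_top_normal p G
    have hQ : SinksLE (G ⧸ pcore p (⊤ : Subgroup G)) (m + 1) :=
      h.of_surjective _ (QuotientGroup.mk'_surjective _)
    have hS : BoundedSinks p (m + 1) ((b + 1) * (m + 1) ^ (m + 1)) ((m + 1) ^ (m + 1))
        (G ⧸ pcore p (⊤ : Subgroup G)) := by
      refine ⟨hQ, fun N hN hNp => eq_bot_of_normal_quotient_pcore hN hNp,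
        fun g S hS => centralizer_rsink_relIndex_le hQ (Nat.succ_pos m) hS,
        fun g hg => pBdd_centralizer hQ (fun z y k hk hz hz1 => ?_) hg⟩
      refine PBdd.of_top (PBdd.of_quotient_central (A := (closure (Set.range (engel z y))).subgroupOf
        (centralizer (closure (Set.range (engel z y))))) (fun x hx => ?_) ?_)
      · rw [mem_center_iff]
        intro a
        exact Subtype.ext (mem_centralizer_iff.1 a.2 _ hx).symm
      · exact fun S hS hSp =>
          (hb _ (hQ.quotient_centralizer hk hz hz1) p S hS hSp).trans (Nat.le_succ b)
    intro S _ hSp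
    have h1 : pcore p (⊤ : Subgroup G) = (⊥ : Subgroup (G ⧸ pcore p (⊤ : Subgroup G))).comap
        (QuotientGroup.mk' _) := by
      rw [MonoidHom.comap_bot, QuotientGroup.ker_mk']
    have h2 : (pcore p (⊤ : Subgroup G)).relIndex S =
        Nat.card (S.map (QuotientGroup.mk' (pcore p (⊤ : Subgroup G)))) := by
      rw [← relIndex_bot_left, ← relIndex_comap, ← h1]
    rw [h2]
    obtain ⟨P, hP⟩ := (hSp.map (QuotientGroup.mk' (pcore p (⊤ : Subgroup G)))).exists_le_sylow
    refine (card_le_of_le hP).trans (card_sylow_le hS ?_ ?_ P) <;> positivity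

theorem card_sylow_le_of_simple [Finite G] [Fact p.Prime] (hG : IsSimpleGroup G)
    (hab : ¬ ∀ a b : G, a * b = b * a) (h : PBdd p b (⊤ : Subgroup G)) (P : Sylow p G) :
    Nat.card (P : Subgroup G) ≤ b := by
  have h1 := h P le_top P.isPGroup'
  rcases (pcore_top_normal p G).eq_bot_or_eq_top with h2 | h2
  · rwa [h2, relIndex_bot_left] at h1
  · exfalso
    have h3 : IsPGroup p (⊤ : Subgroup G) := h2 ▸ isPGroup_pcore _
    have h4 : IsPGroup p G := h3.of_equiv topEquiv
    have h5 := h4.center_nontrivial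
    rcases (inferInstance : (center G).Normal).eq_bot_or_eq_top with h6 | h6
    · exact (nontrivial_iff_ne_bot _).1 h5 h6
    · exact hab fun x y => (mem_center_iff.1 (h6 ▸ mem_top x : x ∈ center G) y).symm

theorem card_le_of_card_sylow_le [Finite G]
    (h : ∀ (p : ℕ) [Fact p.Prime] (P : Sylow p G), Nat.card (P : Subgroup G) ≤ b) :
    Nat.card G ≤ (b + 1) ^ b := by
  have h1 : ∀ p ∈ (Nat.card G).primeFactors, p ^ (Nat.card G).factorization p ≤ b := by
    intro p hp
    have := Fact.mk (Nat.prime_of_mem_primeFactors hp)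
    obtain ⟨P⟩ := (inferInstance : Nonempty (Sylow p G))
    rw [← P.card_eq_multiplicity]
    exact h p P
  have h2 : (Nat.card G).primeFactors ⊆ Finset.Icc 1 b := by
    intro p hp
    have hpp := Nat.prime_of_mem_primeFactors hp
    refine Finset.mem_Icc.2 ⟨hpp.one_le, le_trans ?_ (h1 p hp)⟩
    refine Nat.le_self_pow ?_ p
    exact Finsupp.mem_support_iff.1 hp
  rw [← Nat.prod_factorization_pow_eq_self (n := Nat.card G) Nat.card_pos.ne', Finsupp.prod]
  refine (Finset.prod_le_pow_card _ _ (b + 1) fun p hp => (h1 p hp).trans (Nat.le_succ b)).trans ?_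
  refine Nat.pow_le_pow_right (Nat.succ_pos b) ((Finset.card_le_card h2).trans ?_)
  rw [Nat.card_Icc, Nat.add_sub_cancel]

end Reduction

theorem simple_bounded_right_engel_sinks :
    ∃ f : ℕ → ℕ, ∀ (m : ℕ) (G : Type u) [Group G] [Finite G], IsSimpleGroup G →
      (¬ ∀ a b : G, a * b = b * a) →
      (∀ g : G, ∃ R : Finset G, R.card ≤ m ∧ IsRightEngelSink g ↑R) →
      Nat.card G ≤ f m := by
  choose b hb using exists_pBdd.{u}
  refine ⟨fun m => (b m + 1) ^ b m, fun m G _ _ hG hab h => card_le_of_card_sylow_le fun p _ P =>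
    card_sylow_le_of_simple hG hab (hb m G (fun g => ?_) p) P⟩
  obtain ⟨R, hR, hg⟩ := h g
  refine (Set.ncard_le_ncard (rsink_subset hg) R.finite_toSet).trans ?_
  rwa [Set.ncard_coe_finset]
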